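/- The equation −Δ^{α/2}u = ρ·φ(u) admits a nonnegative entire bounded solution u on ℝ^N with lim_{|x|→∞} u(x) = 0 if and only if lim_{|x|→∞} ∫_{ℝ^N} ρ(y)·|x−y|^{-(N−α)} dy = 0. -/

import Mathlib

open MeasureTheory Real Filter Topology
open scoped ENNReal

noncomputable section

/-- The constant `c_{N,-α} = 2^α · π^{-N/2} · Γ((N+α)/2) / |Γ(-α/2)|`. -/
def fracLapCoeff (N : ℕ) (α : ℝ) : ℝ :=
  2 ^ α * Real.pi ^ (-(N : ℝ) / 2) * Real.Gamma (((N : ℝ) + α) / 2) / |Real.Gamma (-α / 2)|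

/-- The fractional Laplacian `Δ^{α/2}θ` of a test function `θ`. -/
def fracLap (N : ℕ) (α : ℝ) (θ : EuclideanSpace ℝ (Fin N) → ℝ)
    (x : EuclideanSpace ℝ (Fin N)) : ℝ :=
  (fracLapCoeff N α / 2) *
    ∫ z : EuclideanSpace ℝ (Fin N), (θ (x + z) + θ (x - z) - 2 * θ x) / ‖z‖ ^ ((N : ℝ) + α)

/-- A nonnegative entire bounded (distributional) solution of `-Δ^{α/2}u = ρ·φ(u)` on
`ℝ^N`; here `φ : ℝ → ℝ≥0∞` is extended-real-valued (`φ(0)` may be `∞`), the local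
integrability of `ρ·φ(u)` is expressed via the lower integral. -/
def NegEntireSol (N : ℕ) (α : ℝ) (ρ : EuclideanSpace ℝ (Fin N) → ℝ) (φ : ℝ → ℝ≥0∞)
    (u : EuclideanSpace ℝ (Fin N) → ℝ) : Prop :=
  Continuous u ∧ (∃ M, ∀ x, u x ≤ M) ∧ (∀ x, 0 ≤ u x) ∧
  (∀ K : Set (EuclideanSpace ℝ (Fin N)), IsCompact K →
    (∫⁻ x in K, ENNReal.ofReal (ρ x) * φ (u x)) ≠ ⊤) ∧
  ∀ θ : EuclideanSpace ℝ (Fin N) → ℝ, ContDiff ℝ (⊤ : ℕ∞) θ → HasCompactSupport θ →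
    (∫ x, u x * fracLap N α θ x) =
      -∫ x, (ENNReal.ofReal (ρ x) * φ (u x)).toReal * θ x

set_option linter.unusedSectionVars false

namespace FractionalPoisson

section HeatKernel

variable {E : Type*} [NormedAddCommGroup E] [InnerProductSpace ℝ E] [FiniteDimensional ℝ E]
  [MeasurableSpace E] [BorelSpace E]

/-- The dimension of `E` as a real number. -/
abbrev dim (E : Type*) [NormedAddCommGroup E] [InnerProductSpace ℝ E] : ℝ :=
  (Module.finrank ℝ E : ℝ)

/-- The Gauss-Weierstrass heat kernel. -/
def heatKernel (t : ℝ) (x : E) : ℝ :=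
  (4 * π * t) ^ (-(dim E) / 2) * rexp (-(1 / (4 * t)) * ‖x‖ ^ 2)

theorem integrableOn_min_rpow {p q : ℝ} (hp : -1 < p) (hq : q < -1) :
    IntegrableOn (fun t : ℝ => min (t ^ p) (t ^ q)) (Set.Ioi 0) := by
  have hm : Measurable (fun t : ℝ => min (t ^ p) (t ^ q)) := by fun_prop
  rw [← Set.Ioc_union_Ioi_eq_Ioi (zero_le_one (α := ℝ))]
  refine IntegrableOn.union ?_ ?_
  · have h : IntegrableOn (fun t : ℝ => t ^ p) (Set.Ioc 0 1) :=
      (intervalIntegrable_iff_integrableOn_Ioc_of_le zero_le_one).1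
        (intervalIntegral.intervalIntegrable_rpow' hp)
    refine Integrable.mono' h hm.aestronglyMeasurable ?_
    filter_upwards [ae_restrict_mem measurableSet_Ioc] with t ht
    rw [Real.norm_of_nonneg (le_min (rpow_nonneg ht.1.le _) (rpow_nonneg ht.1.le _))]
    exact min_le_left _ _
  · have h : IntegrableOn (fun t : ℝ => t ^ q) (Set.Ioi 1) :=
      integrableOn_Ioi_rpow_of_lt hq zero_lt_one
    refine Integrable.mono' h hm.aestronglyMeasurable ?_
    filter_upwards [ae_restrict_mem measurableSet_Ioi] with t ht
    have ht0 : (0 : ℝ) ≤ t := zero_le_one.trans (le_of_lt ht)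
    rw [Real.norm_of_nonneg (le_min (rpow_nonneg ht0 _) (rpow_nonneg ht0 _))]
    exact min_le_right _ _

theorem heatKernel_nonneg {t : ℝ} (ht : 0 < t) (x : E) : 0 ≤ heatKernel t x := by
  unfold heatKernel; positivity

theorem heatKernel_neg (t : ℝ) (x : E) : heatKernel t (-x) = heatKernel t x := by
  simp [heatKernel]

theorem heatKernel_le {t : ℝ} (ht : 0 < t) (x : E) :
    heatKernel t x ≤ (4 * π * t) ^ (-(dim E) / 2) := by
  unfold heatKernel
  refine mul_le_of_le_one_right (by positivity) (Real.exp_le_one_iff.2 ?_)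
  have : 0 ≤ 1 / (4 * t) * ‖x‖ ^ 2 := by positivity
  linarith

theorem continuous_heatKernel (t : ℝ) : Continuous (heatKernel t : E → ℝ) := by
  unfold heatKernel; fun_prop

theorem measurable_heatKernel : Measurable (fun p : ℝ × E => heatKernel p.1 p.2) := by
  unfold heatKernel; fun_prop

theorem integrable_exp_neg_mul_sq_norm {b : ℝ} (hb : 0 < b) :
    Integrable (fun v : E => rexp (-b * ‖v‖ ^ 2)) := by
  by_contra h
  have h1 := GaussianFourier.integral_rexp_neg_mul_sq_norm (V := E) hb
  rw [integral_undef h] at h1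
  have : 0 < (π / b) ^ ((Module.finrank ℝ E : ℝ) / 2) := by positivity
  linarith

theorem integrable_heatKernel {t : ℝ} (ht : 0 < t) : Integrable (heatKernel t : E → ℝ) :=
  (integrable_exp_neg_mul_sq_norm (by positivity)).const_mul _

theorem integral_heatKernel {t : ℝ} (ht : 0 < t) : ∫ x : E, heatKernel t x = 1 := by
  unfold heatKernel
  rw [integral_const_mul, GaussianFourier.integral_rexp_neg_mul_sq_norm (by positivity)]
  have : π / (1 / (4 * t)) = 4 * π * t := by field_simp
  rw [this, ← rpow_add (by positivity)]
  simp [neg_div]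

theorem heatKernel_conv {s t : ℝ} (hs : 0 < s) (ht : 0 < t) (x : E) :
    ∫ y : E, heatKernel s y * heatKernel t (x - y) = heatKernel (s + t) x := by
  have hst : 0 < s + t := by positivity
  have key : ∀ y : E, heatKernel s y * heatKernel t (x - y) =
      ((4 * π * s) ^ (-(dim E) / 2) * (4 * π * t) ^ (-(dim E) / 2) *
        rexp (-(1 / (4 * (s + t))) * ‖x‖ ^ 2)) *
      rexp (-((s + t) / (4 * s * t)) * ‖y - (s / (s + t)) • x‖ ^ 2) := by
    intro y
    unfold heatKernel
    have : rexp (-(1 / (4 * s)) * ‖y‖ ^ 2) * rexp (-(1 / (4 * t)) * ‖x - y‖ ^ 2) =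
        rexp (-(1 / (4 * (s + t))) * ‖x‖ ^ 2) *
        rexp (-((s + t) / (4 * s * t)) * ‖y - (s / (s + t)) • x‖ ^ 2) := by
      rw [← Real.exp_add, ← Real.exp_add, norm_sub_sq_real, norm_sub_sq_real, norm_smul,
        real_inner_smul_right, real_inner_comm y x, Real.norm_of_nonneg (by positivity)]
      congr 1
      field_simp
      ring
    linear_combination ((4 * π * s) ^ (-(dim E) / 2) * (4 * π * t) ^ (-(dim E) / 2)) * this
  simp_rw [key]
  rw [integral_const_mul, integral_sub_right_eq_self
    (fun y : E => rexp (-((s + t) / (4 * s * t)) * ‖y‖ ^ 2)),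
    GaussianFourier.integral_rexp_neg_mul_sq_norm (by positivity)]
  unfold heatKernel
  have e1 : (π / ((s + t) / (4 * s * t))) ^ ((Module.finrank ℝ E : ℝ) / 2) =
      (4 * π * s) ^ (dim E / 2) * (4 * π * t) ^ (dim E / 2) * (4 * π * (s + t)) ^ (-(dim E) / 2) := by
    rw [neg_div, rpow_neg (by positivity), ← div_eq_mul_inv,
      ← mul_rpow (by positivity) (by positivity), ← div_rpow (by positivity) (by positivity)]
    congr 1
    field_simp
  have e2 : ∀ r : ℝ, 0 < r → r ^ (-(dim E) / 2) * r ^ (dim E / 2) = 1 := by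
    intro r hr
    rw [← rpow_add hr]; simp [neg_div]
  rw [e1]
  linear_combination ((4 * π * (s + t)) ^ (-(dim E) / 2) * rexp (-(1 / (4 * (s + t))) * ‖x‖ ^ 2)) *
    ((4 * π * t) ^ (-(dim E) / 2) * (4 * π * t) ^ (dim E / 2) * e2 (4 * π * s) (by positivity) +
    e2 (4 * π * t) (by positivity))

theorem heatKernel_mul_sq_norm_le {t : ℝ} (ht : 0 < t) (x : E) :
    heatKernel t x * ‖x‖ ^ 2 ≤ 8 * 2 ^ (dim E / 2) * t * heatKernel (2 * t) x := by
  unfold heatKernel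
  have h1 : (4 * π * (2 * t)) ^ (-(dim E) / 2) = 2 ^ (-(dim E) / 2) * (4 * π * t) ^ (-(dim E) / 2) := by
    rw [← mul_rpow (by positivity) (by positivity)]; ring_nf
  have h2 : (2 : ℝ) ^ (dim E / 2) * 2 ^ (-(dim E) / 2) = 1 := by
    rw [← rpow_add (by positivity)]; simp [neg_div]
  set u := 1 / (4 * (2 * t)) * ‖x‖ ^ 2 with hu
  have hx : ‖x‖ ^ 2 = 8 * t * u := by rw [hu]; field_simp; ring
  have h3 : rexp (-(1 / (4 * t)) * ‖x‖ ^ 2) = rexp (-u) * rexp (-u) := by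
    rw [← Real.exp_add, hu]; congr 1; field_simp; ring
  have h4 : -(1 / (4 * (2 * t))) * ‖x‖ ^ 2 = -u := by rw [hu]; ring
  have h5 : u * rexp (-u) ≤ 1 := by
    have := Real.add_one_le_exp u
    rw [Real.exp_neg, ← div_eq_mul_inv, div_le_one (Real.exp_pos _)]; linarith
  rw [h1, h3, h4, hx]
  have h6 : 0 ≤ (4 * π * t) ^ (-(dim E) / 2) * rexp (-u) * (8 * t) := by positivity
  calc _ = (4 * π * t) ^ (-(dim E) / 2) * rexp (-u) * (8 * t) * (u * rexp (-u)) := by ring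
    _ ≤ (4 * π * t) ^ (-(dim E) / 2) * rexp (-u) * (8 * t) * 1 := by gcongr
    _ = (4 * π * t) ^ (-(dim E) / 2) * rexp (-u) * (8 * t) *
      ((2 : ℝ) ^ (dim E / 2) * 2 ^ (-(dim E) / 2)) := by rw [h2]
    _ = _ := by ring

theorem integrable_heatKernel_mul_min {t : ℝ} (ht : 0 < t) :
    Integrable (fun x : E => heatKernel t x * min 1 (‖x‖ ^ 2)) := by
  refine Integrable.mono' (integrable_heatKernel ht)
    ((continuous_heatKernel t).mul (by fun_prop)).aestronglyMeasurable (ae_of_all _ fun x => ?_)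
  have h0 : 0 ≤ min 1 (‖x‖ ^ 2) := by positivity
  rw [Real.norm_of_nonneg (mul_nonneg (heatKernel_nonneg ht x) h0)]
  exact mul_le_of_le_one_right (heatKernel_nonneg ht x) (min_le_left _ _)

/-- A bound for the truncated second moment of the heat kernel. -/
theorem integral_heatKernel_mul_min_le {t : ℝ} (ht : 0 < t) :
    ∫ x : E, heatKernel t x * min 1 (‖x‖ ^ 2) ≤ (8 * 2 ^ (dim E / 2)) * min 1 t := by
  have hc : (1 : ℝ) ≤ 8 * 2 ^ (dim E / 2) := by
    have : (1 : ℝ) ≤ 2 ^ (dim E / 2) := one_le_rpow (by norm_num) (by positivity)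
    linarith
  have h1 : ∫ x : E, heatKernel t x * min 1 (‖x‖ ^ 2) ≤ 1 := by
    refine (integral_mono (integrable_heatKernel_mul_min ht) (integrable_heatKernel ht)
      fun x => ?_).trans_eq (integral_heatKernel (E := E) ht)
    exact mul_le_of_le_one_right (heatKernel_nonneg ht x) (min_le_left _ _)
  have h2 : ∫ x : E, heatKernel t x * min 1 (‖x‖ ^ 2) ≤ 8 * 2 ^ (dim E / 2) * t := by
    have : ∫ x : E, 8 * 2 ^ (dim E / 2) * t * heatKernel (2 * t) x = 8 * 2 ^ (dim E / 2) * t := by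
      rw [integral_const_mul, integral_heatKernel (by positivity), mul_one]
    rw [← this]
    refine integral_mono (integrable_heatKernel_mul_min ht)
      ((integrable_heatKernel (by positivity)).const_mul _) fun x => ?_
    refine le_trans ?_ (heatKernel_mul_sq_norm_le ht x)
    exact mul_le_mul_of_nonneg_left (min_le_right _ _) (heatKernel_nonneg ht x)
  rw [mul_min_of_nonneg _ _ (by positivity)]
  exact le_min (by linarith) h2

/-- The normalising constant relating the Mellin transform of the heat kernel to a power. -/
def heatConst (E : Type*) [NormedAddCommGroup E] [InnerProductSpace ℝ E] (b : ℝ) : ℝ :=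
  (4 * π) ^ (-(dim E) / 2) * (4 ^ (dim E / 2 - b) * Real.Gamma (dim E / 2 - b))

theorem heatConst_pos {b : ℝ} (hb : b < dim E / 2) : 0 < heatConst E b := by
  have := Real.Gamma_pos_of_pos (sub_pos.2 hb)
  unfold heatConst; positivity

theorem integral_rpow_mul_heatKernel {b : ℝ} (hb : b < dim E / 2) {x : E} (hx : x ≠ 0) :
    ∫ t in Set.Ioi (0 : ℝ), t ^ (b - 1) * heatKernel t x =
      heatConst E b * ‖x‖ ^ (2 * b - dim E) := by
  have hx' : 0 < ‖x‖ := norm_pos_iff.2 hx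
  set q := dim E / 2 - b with hq
  have hq0 : 0 < q := sub_pos.2 hb
  have h1 := integral_rpow_mul_exp_neg_mul_Ioi hq0 (r := ‖x‖ ^ 2 / 4) (by positivity)
  rw [← integral_comp_rpow_Ioi _ (p := -1) (by norm_num)] at h1
  have h2 : ∫ t in Set.Ioi (0 : ℝ), t ^ (b - 1) * heatKernel t x =
      ∫ t in Set.Ioi (0 : ℝ), (4 * π) ^ (-(dim E) / 2) * ((|(-1 : ℝ)| * t ^ ((-1 : ℝ) - 1)) •
        ((t ^ (-1 : ℝ)) ^ (q - 1) * rexp (-(‖x‖ ^ 2 / 4 * t ^ (-1 : ℝ))))) := by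
    refine setIntegral_congr_fun measurableSet_Ioi fun t (ht : 0 < t) => ?_
    simp only [heatKernel, abs_neg, abs_one, one_mul, smul_eq_mul]
    have e1 : rexp (-(1 / (4 * t)) * ‖x‖ ^ 2) = rexp (-(‖x‖ ^ 2 / 4 * t ^ (-1 : ℝ))) := by
      rw [rpow_neg_one]; congr 1; field_simp
    have e2 : t ^ (b - 1) * t ^ (-(dim E) / 2) = t ^ ((-1 : ℝ) - 1) * (t ^ (-1 : ℝ)) ^ (q - 1) := by
      rw [← rpow_mul ht.le, ← rpow_add ht, ← rpow_add ht]; congr 1; rw [hq]; ring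
    rw [e1, mul_rpow (by positivity) ht.le]
    linear_combination (4 * π) ^ (-(dim E) / 2) * rexp (-(‖x‖ ^ 2 / 4 * t ^ (-1 : ℝ))) * e2
  rw [h2, integral_const_mul, h1, heatConst, ← hq]
  have e3 : (1 / (‖x‖ ^ 2 / 4)) ^ q = 4 ^ q * ‖x‖ ^ (2 * b - dim E) := by
    have : 2 * b - dim E = -(2 * q) := by rw [hq]; ring
    rw [one_div_div, div_rpow (by positivity) (by positivity), this, rpow_neg hx'.le, rpow_mul hx'.le]
    norm_num [div_eq_mul_inv]
  rw [e3]; ring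

end HeatKernel

section SecondDifference

variable {E : Type*} [NormedAddCommGroup E] [InnerProductSpace ℝ E] [FiniteDimensional ℝ E]
  [MeasurableSpace E] [BorelSpace E]

/-- The symmetric second difference of `θ` at `x` in direction `z`. -/
def secondDiff (θ : E → ℝ) (x z : E) : ℝ := θ (x + z) + θ (x - z) - 2 * θ x

theorem abs_secondDiff_le {θ : E → ℝ} {A : ℝ} (hA : ∀ x, |θ x| ≤ A) (x z : E) :
    |secondDiff θ x z| ≤ 4 * A := by
  unfold secondDiff
  have h1 := abs_le.1 (hA (x + z))
  have h2 := abs_le.1 (hA (x - z))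
  have h3 := abs_le.1 (hA x)
  rw [abs_le]; constructor <;> linarith

theorem continuous_secondDiff {θ : E → ℝ} (hθ : Continuous θ) :
    Continuous (fun p : E × E => secondDiff θ p.1 p.2) := by
  unfold secondDiff; fun_prop

theorem integrable_secondDiff {θ : E → ℝ} (hθ : Integrable θ) (z : E) :
    Integrable (fun x => secondDiff θ x z) :=
  ((hθ.comp_add_right z).add (hθ.comp_sub_right z)).sub (hθ.const_mul 2)

theorem exists_abs_secondDiff_le_sq {θ : E → ℝ} (hθ : ContDiff ℝ (⊤ : ℕ∞) θ)
    (hc : HasCompactSupport θ) : ∃ C, 0 ≤ C ∧ ∀ x z, |secondDiff θ x z| ≤ C * ‖z‖ ^ 2 := by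
  obtain ⟨C, hC⟩ := ContDiff.lipschitzWith_of_hasCompactSupport (𝕂 := ℝ) (n := 1)
    (f := fderiv ℝ θ) (hc.fderiv ℝ) (hθ.fderiv_right (by norm_cast)) (by norm_num)
  have hd : Differentiable ℝ θ := hθ.differentiable (by norm_num)
  refine ⟨C, C.2, fun x z => ?_⟩
  have key := Convex.norm_image_sub_le_of_norm_fderiv_le (𝕜 := ℝ) (f := fun v => θ (v + z) - θ v)
    (C := C * ‖z‖) (s := Set.univ) (x := x - z) (y := x)
    (fun v _ => by fun_prop) (fun v _ => by
      rw [fderiv_fun_sub (by fun_prop) (by fun_prop), fderiv_comp_add_right]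
      have := hC.dist_le_mul (v + z) v
      simpa [dist_eq_norm] using this) convex_univ (Set.mem_univ _) (Set.mem_univ _)
  simp only [sub_add_cancel, sub_sub_cancel, Real.norm_eq_abs] at key
  have e : secondDiff θ x z = θ (x + z) - θ x - (θ x - θ (x - z)) := by unfold secondDiff; ring
  rw [e]; exact key.trans_eq (by ring)

/-- Uniform and integral bounds for the second differences of a test function. -/
theorem exists_secondDiff_bound {θ : E → ℝ} (hθ : ContDiff ℝ (⊤ : ℕ∞) θ)
    (hc : HasCompactSupport θ) : ∃ C, 0 ≤ C ∧
      (∀ x z, |secondDiff θ x z| ≤ C * min 1 (‖z‖ ^ 2)) ∧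
      ∀ z, ∫ x, |secondDiff θ x z| ≤ C * min 1 (‖z‖ ^ 2) := by
  obtain ⟨C, hC0, hC⟩ := exists_abs_secondDiff_le_sq hθ hc
  have hi : Integrable θ := hθ.continuous.integrable_of_hasCompactSupport hc
  obtain ⟨A, hA⟩ := hc.exists_bound_of_continuous hθ.continuous
  have hA0 : 0 ≤ A := (norm_nonneg _).trans (hA 0)
  obtain ⟨R, hR⟩ := hc.isCompact.isBounded.subset_closedBall 0
  set V := (volume (Metric.closedBall (0 : E) (R + 1))).toReal with hV
  set I := ∫ x, |θ x| with hI
  have hI0 : 0 ≤ I := integral_nonneg fun _ => abs_nonneg _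
  have hV0 : 0 ≤ V := ENNReal.toReal_nonneg
  have h4 : ∀ z, ∫ x, |secondDiff θ x z| ≤ 4 * I := by
    intro z
    have h1 : Integrable (fun x => |θ (x + z)|) := (hi.comp_add_right z).abs
    have h2 : Integrable (fun x => |θ (x - z)|) := (hi.comp_sub_right z).abs
    have h12 : Integrable (fun x => |θ (x + z)| + |θ (x - z)|) := h1.add h2
    have h3 : Integrable (fun x => 2 * |θ x|) := hi.abs.const_mul 2
    calc ∫ x, |secondDiff θ x z| ≤ ∫ x, (|θ (x + z)| + |θ (x - z)| + 2 * |θ x|) := by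
          refine integral_mono (integrable_secondDiff hi z).abs (h12.add h3) fun x => ?_
          unfold secondDiff
          refine (abs_sub _ _).trans (add_le_add (abs_add_le _ _) ?_)
          rw [abs_mul]; norm_num
      _ = 4 * I := by
          rw [integral_add h12 h3, integral_add h1 h2,
            integral_add_right_eq_self (fun x => |θ x|), integral_sub_right_eq_self (fun x => |θ x|),
            integral_const_mul]
          ring
  have hsm : ∀ z : E, ‖z‖ ≤ 1 → ∫ x, |secondDiff θ x z| ≤ V * C * ‖z‖ ^ 2 := by
    intro z hz
    have hsupp : ∀ x, x ∉ Metric.closedBall (0 : E) (R + 1) → |secondDiff θ x z| = 0 := by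
      intro x hx
      have hx' : R + 1 < ‖x‖ := by simpa using hx
      have hz0 : ∀ y : E, R < ‖y‖ → θ y = 0 := by
        intro y hy
        by_contra hne
        have := hR (subset_tsupport _ hne)
        simp only [Metric.mem_closedBall, dist_zero_right] at this
        linarith
      have h1 : R < ‖x + z‖ := by
        have := norm_sub_norm_le x (-z); rw [norm_neg, sub_neg_eq_add] at this; linarith
      have h2 : R < ‖x - z‖ := by
        have := norm_sub_norm_le x z; linarith
      simp [secondDiff, hz0 _ h1, hz0 _ h2, hz0 x (by linarith)]
    rw [← setIntegral_eq_integral_of_forall_compl_eq_zero hsupp]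
    have hfin : volume (Metric.closedBall (0 : E) (R + 1)) < ⊤ := measure_closedBall_lt_top
    calc ∫ x in Metric.closedBall (0 : E) (R + 1), |secondDiff θ x z|
        ≤ ∫ x in Metric.closedBall (0 : E) (R + 1), C * ‖z‖ ^ 2 :=
          setIntegral_mono (integrable_secondDiff hi z).abs.integrableOn
            (integrableOn_const hfin.ne) fun x => hC x z
      _ = V * C * ‖z‖ ^ 2 := by
          rw [setIntegral_const, smul_eq_mul, measureReal_def]; ring
  refine ⟨C + 4 * A + V * C + 4 * I, by positivity, fun x z => ?_, fun z => ?_⟩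
  · rcases le_total (‖z‖ ^ 2) 1 with h | h
    · rw [min_eq_right h]
      refine (hC x z).trans (mul_le_mul_of_nonneg_right ?_ (by positivity))
      have : 0 ≤ V * C := by positivity
      linarith
    · rw [min_eq_left h, mul_one]
      have := abs_secondDiff_le hA x z
      have : 0 ≤ V * C := by positivity
      linarith
  · rcases le_total (‖z‖ ^ 2) 1 with h | h
    · rw [min_eq_right h]
      refine (hsm z (by nlinarith [norm_nonneg z])).trans
        (mul_le_mul_of_nonneg_right ?_ (by positivity))
      linarith
    · rw [min_eq_left h, mul_one]
      have := h4 z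
      have : 0 ≤ V * C := by positivity
      linarith

end SecondDifference

section HeatOperator

variable {E : Type*} [NormedAddCommGroup E] [InnerProductSpace ℝ E] [FiniteDimensional ℝ E]
  [MeasurableSpace E] [BorelSpace E]

/-- The heat semigroup acting on functions. -/
def heatOp (t : ℝ) (ζ : E → ℝ) (x : E) : ℝ := ∫ y, heatKernel t y * ζ (x - y)

theorem integrable_heatKernel_mul {t : ℝ} (ht : 0 < t) {ζ : E → ℝ}
    (hζ : Integrable ζ) (x : E) : Integrable (fun y => heatKernel t y * ζ (x - y)) := by
  refine (hζ.comp_sub_left x).bdd_mul (c := (4 * π * t) ^ (-(dim E) / 2))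
    (continuous_heatKernel t).aestronglyMeasurable (ae_of_all _ fun y => ?_)
  rw [Real.norm_of_nonneg (heatKernel_nonneg ht y)]
  exact heatKernel_le ht y

theorem heatKernel_le_rpow {t : ℝ} (ht : 0 < t) (x : E) :
    heatKernel t x ≤ t ^ (-(dim E) / 2) := by
  refine (heatKernel_le ht x).trans ?_
  refine rpow_le_rpow_of_nonpos ht ?_ ?_
  · have := Real.pi_gt_three
    nlinarith
  · have : 0 ≤ dim E := by positivity
    linarith

theorem integral_heatKernel_mul_abs_le {t : ℝ} (ht : 0 < t) {ζ : E → ℝ} {A : ℝ}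
    (hζ : Integrable ζ) (hA : ∀ x, |ζ x| ≤ A) (hA1 : ∫ x, |ζ x| ≤ A) (x : E) :
    ∫ y, heatKernel t y * |ζ (x - y)| ≤ A * min 1 (t ^ (-(dim E) / 2)) := by
  have hA0 : 0 ≤ A := (abs_nonneg _).trans (hA 0)
  have hi : Integrable (fun y => heatKernel t y * |ζ (x - y)|) :=
    integrable_heatKernel_mul ht hζ.abs x
  rw [mul_min_of_nonneg _ _ hA0]
  refine le_min ?_ ?_
  · calc ∫ y, heatKernel t y * |ζ (x - y)| ≤ ∫ y : E, A * heatKernel t y := by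
          refine integral_mono hi ((integrable_heatKernel ht).const_mul _) fun y => ?_
          have := mul_le_mul_of_nonneg_left (hA (x - y)) (heatKernel_nonneg ht y)
          simpa [mul_comm] using this
      _ = A * 1 := by rw [integral_const_mul, integral_heatKernel ht]
  · calc ∫ y, heatKernel t y * |ζ (x - y)| ≤ ∫ y : E, t ^ (-(dim E) / 2) * |ζ (x - y)| := by
          refine integral_mono hi ((hζ.comp_sub_left x).abs.const_mul _) fun y => ?_
          exact mul_le_mul_of_nonneg_right (heatKernel_le_rpow ht y) (abs_nonneg _)
      _ = t ^ (-(dim E) / 2) * ∫ y, |ζ y| := by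
          rw [integral_const_mul, integral_sub_left_eq_self (fun y => |ζ y|)]
      _ ≤ A * t ^ (-(dim E) / 2) := by
          rw [mul_comm]; exact mul_le_mul_of_nonneg_right hA1 (by positivity)

theorem abs_heatOp_le {t : ℝ} (ht : 0 < t) {ζ : E → ℝ} {A : ℝ}
    (hζ : Integrable ζ) (hA : ∀ x, |ζ x| ≤ A) (hA1 : ∫ x, |ζ x| ≤ A) (x : E) :
    |heatOp t ζ x| ≤ A * min 1 (t ^ (-(dim E) / 2)) := by
  refine le_trans ?_ (integral_heatKernel_mul_abs_le ht hζ hA hA1 x)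
  unfold heatOp
  refine (abs_integral_le_integral_abs).trans_eq (integral_congr_ae (ae_of_all _ fun y => ?_))
  simp only [abs_mul, abs_of_nonneg (heatKernel_nonneg ht y)]

theorem heatOp_eq_integral_sub {t : ℝ} (ζ : E → ℝ) (x : E) :
    heatOp t ζ x = ∫ y, heatKernel t (x - y) * ζ y := by
  unfold heatOp
  rw [← integral_sub_left_eq_self _ volume x]
  simp

theorem continuous_heatOp {t : ℝ} (ht : 0 < t) {ζ : E → ℝ} (hζ : Integrable ζ) :
    Continuous (heatOp t ζ) := by
  have : heatOp t ζ = fun x => ∫ y, heatKernel t (x - y) * ζ y :=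
    funext fun x => heatOp_eq_integral_sub ζ x
  rw [this]
  refine continuous_of_dominated (bound := fun y => (4 * π * t) ^ (-(dim E) / 2) * |ζ y|)
    (fun x => ?_) (fun x => ae_of_all _ fun y => ?_) (hζ.abs.const_mul _)
    (ae_of_all _ fun y => ?_)
  · exact ((continuous_heatKernel t).comp (by fun_prop)).aestronglyMeasurable.mul
      hζ.aestronglyMeasurable
  · rw [norm_mul, Real.norm_of_nonneg (heatKernel_nonneg ht _), Real.norm_eq_abs]
    exact mul_le_mul_of_nonneg_right (heatKernel_le ht _) (abs_nonneg _)
  · exact ((continuous_heatKernel t).comp (by fun_prop)).mul continuous_const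

theorem heatOp_heatOp {s t : ℝ} (hs : 0 < s) (ht : 0 < t) {ζ : E → ℝ} (hζ : Integrable ζ) (x : E) :
    heatOp s (heatOp t ζ) x = heatOp (s + t) ζ x := by
  have h_swap : Integrable (Function.uncurry fun y z : E =>
      heatKernel s y * (heatKernel t (x - y - z) * ζ z)) (volume.prod volume) := by
    have h1 : Integrable (fun p : E × E => heatKernel s p.1 * ζ p.2) (volume.prod volume) :=
      (integrable_heatKernel hs).mul_prod hζ
    have h2 := h1.bdd_mul (f := fun p : E × E => heatKernel t (x - p.1 - p.2))
      (c := (4 * π * t) ^ (-(dim E) / 2))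
      ((continuous_heatKernel t).comp (by fun_prop)).aestronglyMeasurable
      (ae_of_all _ fun p => by
        rw [Real.norm_of_nonneg (heatKernel_nonneg ht _)]; exact heatKernel_le ht _)
    refine h2.congr (ae_of_all _ fun p => ?_)
    simp only [Function.uncurry]; ring
  have h1 : heatOp s (heatOp t ζ) x =
      ∫ y, ∫ z, heatKernel s y * (heatKernel t (x - y - z) * ζ z) := by
    unfold heatOp
    refine integral_congr_ae (ae_of_all _ fun y => ?_)
    simp only
    rw [integral_const_mul]
    congr 1
    exact heatOp_eq_integral_sub (t := t) ζ (x - y)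
  rw [h1, integral_integral_swap h_swap, heatOp_eq_integral_sub]
  refine integral_congr_ae (ae_of_all _ fun z => ?_)
  simp only
  rw [← heatKernel_conv hs ht, ← integral_mul_const]
  refine integral_congr_ae (ae_of_all _ fun y => ?_)
  simp only
  rw [show x - y - z = x - z - y by abel]; ring

end HeatOperator

section HeatSecondDiff

variable {E : Type*} [NormedAddCommGroup E] [InnerProductSpace ℝ E] [FiniteDimensional ℝ E]
  [MeasurableSpace E] [BorelSpace E]

theorem integral_heatKernel_mul_secondDiff {s : ℝ} (hs : 0 < s) {θ : E → ℝ} (hθ : Integrable θ)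
    (x : E) : ∫ z, heatKernel s z * secondDiff θ x z = 2 * (heatOp s θ x - θ x) := by
  have h1 : Integrable (fun z => heatKernel s z * θ (x - z)) := integrable_heatKernel_mul hs hθ x
  have h2 : Integrable (fun z => heatKernel s z * θ (x + z)) := by
    have := h1.comp_neg
    simpa [heatKernel_neg] using this
  have h3 : Integrable (fun z : E => 2 * θ x * heatKernel s z) :=
    (integrable_heatKernel hs).const_mul _
  have e2 : ∫ z, heatKernel s z * θ (x + z) = heatOp s θ x := by
    rw [← integral_neg_eq_self]
    simp [heatKernel_neg, heatOp, sub_eq_add_neg]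
  have h21 : Integrable (fun z => heatKernel s z * θ (x + z) + heatKernel s z * θ (x - z)) :=
    h2.add h1
  calc ∫ z, heatKernel s z * secondDiff θ x z
      = ∫ z, (heatKernel s z * θ (x + z) + heatKernel s z * θ (x - z)
          - 2 * θ x * heatKernel s z) := by
        refine integral_congr_ae (ae_of_all _ fun z => ?_)
        simp only [secondDiff]; ring
    _ = _ := by
        rw [integral_sub h21 h3, integral_add h2 h1, e2, integral_const_mul, integral_heatKernel hs]
        unfold heatOp; ring

theorem abs_heatOp_sub_self_le {s : ℝ} (hs : 0 < s) {θ : E → ℝ} (hθ : Integrable θ) {C : ℝ}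
    (hC : ∀ x z, |secondDiff θ x z| ≤ C * min 1 (‖z‖ ^ 2)) (hC0 : 0 ≤ C) (x : E) :
    |heatOp s θ x - θ x| ≤ C * (8 * 2 ^ (dim E / 2)) * min 1 s := by
  have h := integral_heatKernel_mul_secondDiff hs hθ x
  have h2 : |∫ z, heatKernel s z * secondDiff θ x z| ≤ C * (8 * 2 ^ (dim E / 2)) * min 1 s := by
    rw [← Real.norm_eq_abs]
    refine (norm_integral_le_of_norm_le ((integrable_heatKernel_mul_min (E := E) hs).const_mul C)
      (ae_of_all _ fun z => ?_)).trans ?_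
    · rw [norm_mul, Real.norm_of_nonneg (heatKernel_nonneg hs z), Real.norm_eq_abs]
      have := mul_le_mul_of_nonneg_left (hC x z) (heatKernel_nonneg hs z)
      linarith
    · rw [integral_const_mul, mul_assoc]
      exact mul_le_mul_of_nonneg_left (integral_heatKernel_mul_min_le (E := E) hs) hC0
  rw [h, abs_mul, abs_of_pos (by norm_num : (0 : ℝ) < 2)] at h2
  have := abs_nonneg (heatOp s θ x - θ x)
  linarith

theorem integrable_heatKernel_heatKernel_secondDiff {t s : ℝ} (ht : 0 < t) (hs : 0 < s)
    {θ : E → ℝ} (hθ : Continuous θ) {A : ℝ} (hA : ∀ x, |θ x| ≤ A) (x : E) :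
    Integrable (fun q : E × E => heatKernel t q.1 * heatKernel s q.2 * secondDiff θ (x - q.1) q.2)
      (volume.prod volume) := by
  refine Integrable.mul_bdd (c := 4 * A)
    ((integrable_heatKernel ht).mul_prod (integrable_heatKernel hs)) ?_ (ae_of_all _ fun q => ?_)
  · exact ((continuous_secondDiff hθ).comp
      (by fun_prop : Continuous fun q : E × E => (x - q.1, q.2))).aestronglyMeasurable
  · exact abs_secondDiff_le hA _ _

theorem integral_heatKernel_heatKernel_secondDiff {t s : ℝ} (ht : 0 < t) (hs : 0 < s)
    {θ : E → ℝ} (hθ : Continuous θ) (hi : Integrable θ) {A : ℝ} (hA : ∀ x, |θ x| ≤ A) (x : E) :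
    ∫ q : E × E, heatKernel t q.1 * heatKernel s q.2 * secondDiff θ (x - q.1) q.2
      ∂(volume.prod volume) = 2 * (heatOp (t + s) θ x - heatOp t θ x) := by
  rw [integral_prod _ (integrable_heatKernel_heatKernel_secondDiff ht hs hθ hA x)]
  have h1 : ∀ y : E, ∫ z, heatKernel t y * heatKernel s z * secondDiff θ (x - y) z =
      2 * (heatKernel t y * heatOp s θ (x - y)) - 2 * (heatKernel t y * θ (x - y)) := by
    intro y
    simp_rw [mul_assoc]
    rw [integral_const_mul, integral_heatKernel_mul_secondDiff hs hi]
    ring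
  simp_rw [h1]
  have hb : Integrable (fun y => heatKernel t y * heatOp s θ (x - y)) := by
    refine Integrable.mul_bdd (c := max A (∫ x, |θ x|)) (integrable_heatKernel ht)
      ((continuous_heatOp hs hi).comp (by fun_prop)).aestronglyMeasurable
      (ae_of_all _ fun y => ?_)
    refine (abs_heatOp_le hs hi (fun x => (hA x).trans (le_max_left _ _))
      (le_max_right A _) (x - y)).trans ?_
    exact mul_le_of_le_one_right (le_max_of_le_left ((abs_nonneg _).trans (hA 0))) (min_le_left _ _)
  rw [integral_sub (hb.const_mul 2) ((integrable_heatKernel_mul ht hi x).const_mul 2),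
    integral_const_mul, integral_const_mul]
  have := heatOp_heatOp ht hs hi x
  rw [← this]
  unfold heatOp
  ring

theorem integral_abs_heatKernel_heatKernel_secondDiff_le {t s : ℝ} (ht : 0 < t) (hs : 0 < s)
    {θ : E → ℝ} (hθ : Continuous θ) (hi : Integrable θ) {A C : ℝ} (hA : ∀ x, |θ x| ≤ A)
    (hC0 : 0 ≤ C) (hC : ∀ x z, |secondDiff θ x z| ≤ C * min 1 (‖z‖ ^ 2))
    (hC1 : ∀ z, ∫ x, |secondDiff θ x z| ≤ C * min 1 (‖z‖ ^ 2)) (x : E) :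
    ∫ q : E × E, |heatKernel t q.1 * heatKernel s q.2 * secondDiff θ (x - q.1) q.2|
      ∂(volume.prod volume) ≤
      C * (8 * 2 ^ (dim E / 2)) * (min 1 (t ^ (-(dim E) / 2)) * min 1 s) := by
  have hI := (integrable_heatKernel_heatKernel_secondDiff ht hs hθ hA x).abs
  rw [integral_prod_symm _ hI]
  have hm : 0 ≤ min 1 (t ^ (-(dim E) / 2)) := by positivity
  have h1 : ∀ z : E, ∫ y, |heatKernel t y * heatKernel s z * secondDiff θ (x - y) z| ≤
      (C * min 1 (t ^ (-(dim E) / 2))) * (heatKernel s z * min 1 (‖z‖ ^ 2)) := by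
    intro z
    have h2 := integral_heatKernel_mul_abs_le ht (integrable_secondDiff hi z)
      (fun x => hC x z) (hC1 z) x
    have h3 : ∫ y, |heatKernel t y * heatKernel s z * secondDiff θ (x - y) z| =
        heatKernel s z * ∫ y, heatKernel t y * |secondDiff θ (x - y) z| := by
      rw [← integral_const_mul]
      refine integral_congr_ae (ae_of_all _ fun y => ?_)
      simp only [abs_mul, abs_of_nonneg (heatKernel_nonneg ht y),
        abs_of_nonneg (heatKernel_nonneg hs z)]
      ring
    rw [h3]
    have := mul_le_mul_of_nonneg_left h2 (heatKernel_nonneg hs z)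
    linarith
  refine (integral_mono hI.integral_prod_right
    ((integrable_heatKernel_mul_min hs).const_mul _) h1).trans ?_
  rw [integral_const_mul]
  have := mul_le_mul_of_nonneg_left (integral_heatKernel_mul_min_le (E := E) hs)
    (by positivity : 0 ≤ C * min 1 (t ^ (-(dim E) / 2)))
  linarith

/-- A bound for the increments in time of the heat semigroup. -/
theorem abs_heatOp_add_sub_le {t s : ℝ} (ht : 0 < t) (hs : 0 < s)
    {θ : E → ℝ} (hθ : Continuous θ) (hi : Integrable θ) {A C : ℝ} (hA : ∀ x, |θ x| ≤ A)
    (hC0 : 0 ≤ C) (hC : ∀ x z, |secondDiff θ x z| ≤ C * min 1 (‖z‖ ^ 2))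
    (hC1 : ∀ z, ∫ x, |secondDiff θ x z| ≤ C * min 1 (‖z‖ ^ 2)) (x : E) :
    |2 * (heatOp (t + s) θ x - heatOp t θ x)| ≤
      C * (8 * 2 ^ (dim E / 2)) * (min 1 (t ^ (-(dim E) / 2)) * min 1 s) := by
  rw [← integral_heatKernel_heatKernel_secondDiff ht hs hθ hi hA x]
  exact abs_integral_le_integral_abs.trans
    (integral_abs_heatKernel_heatKernel_secondDiff_le ht hs hθ hi hA hC0 hC hC1 x)

theorem rpow_mul_min_one_rpow {t : ℝ} (ht : 0 < t) (p q : ℝ) :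
    t ^ p * min 1 (t ^ q) = min (t ^ p) (t ^ (p + q)) := by
  rw [mul_min_of_nonneg _ _ (by positivity), mul_one, rpow_add ht]

theorem rpow_mul_min_one {s : ℝ} (hs : 0 < s) (p : ℝ) :
    s ^ p * min 1 s = min (s ^ (p + 1)) (s ^ p) := by
  rw [mul_min_of_nonneg _ _ (by positivity), mul_one, rpow_add hs, rpow_one, min_comm]

theorem integrable_heat_weight {α : ℝ} (hα : 0 < α) (hα2 : α < 2) (hn : α < dim E) :
    Integrable (fun p : ℝ × ℝ => min (p.1 ^ (α / 2 - 1)) (p.1 ^ (α / 2 - 1 + -(dim E) / 2)) *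
      min (p.2 ^ (-(α / 2) - 1 + 1)) (p.2 ^ (-(α / 2) - 1)))
      ((volume.restrict (Set.Ioi 0)).prod (volume.restrict (Set.Ioi 0))) :=
  (integrableOn_min_rpow (by linarith) (by linarith)).mul_prod
    (integrableOn_min_rpow (by linarith) (by linarith))

theorem ae_prod_Ioi_pos : ∀ᵐ p : ℝ × ℝ ∂((volume.restrict (Set.Ioi 0)).prod
    (volume.restrict (Set.Ioi 0))), 0 < p.1 ∧ 0 < p.2 := by
  rw [Measure.prod_restrict]
  filter_upwards [ae_restrict_mem (measurableSet_Ioi.prod measurableSet_Ioi)] with p hp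
  exact ⟨hp.1, hp.2⟩

theorem integrable_heat_secondDiff {α : ℝ} (hα : 0 < α) (hα2 : α < 2) (hn : α < dim E)
    {θ : E → ℝ} (hθ : Continuous θ) (hi : Integrable θ) {A C : ℝ} (hA : ∀ x, |θ x| ≤ A)
    (hC0 : 0 ≤ C) (hC : ∀ x z, |secondDiff θ x z| ≤ C * min 1 (‖z‖ ^ 2))
    (hC1 : ∀ z, ∫ x, |secondDiff θ x z| ≤ C * min 1 (‖z‖ ^ 2)) (x : E) :
    Integrable (fun p : (ℝ × ℝ) × (E × E) =>
      p.1.1 ^ (α / 2 - 1) * p.1.2 ^ (-(α / 2) - 1) *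
        (heatKernel p.1.1 p.2.1 * heatKernel p.1.2 p.2.2 * secondDiff θ (x - p.2.1) p.2.2))
      (((volume.restrict (Set.Ioi 0)).prod (volume.restrict (Set.Ioi 0))).prod
        (volume.prod volume)) := by
  have hm : Measurable (fun p : (ℝ × ℝ) × (E × E) =>
      p.1.1 ^ (α / 2 - 1) * p.1.2 ^ (-(α / 2) - 1) *
        (heatKernel p.1.1 p.2.1 * heatKernel p.1.2 p.2.2 * secondDiff θ (x - p.2.1) p.2.2)) := by
    have m1 : Measurable fun p : (ℝ × ℝ) × (E × E) => p.1.1 := measurable_fst.comp measurable_fst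
    have m2 : Measurable fun p : (ℝ × ℝ) × (E × E) => p.1.2 := measurable_snd.comp measurable_fst
    have m3 : Measurable fun p : (ℝ × ℝ) × (E × E) => p.2.1 := measurable_fst.comp measurable_snd
    have m4 : Measurable fun p : (ℝ × ℝ) × (E × E) => p.2.2 := measurable_snd.comp measurable_snd
    have h1 : Measurable fun p : (ℝ × ℝ) × (E × E) => heatKernel p.1.1 p.2.1 :=
      (measurable_heatKernel (E := E)).comp (g := fun q : ℝ × E => heatKernel q.1 q.2)
        (f := fun p : (ℝ × ℝ) × (E × E) => (p.1.1, p.2.1)) (m1.prodMk m3)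
    have h2 : Measurable fun p : (ℝ × ℝ) × (E × E) => heatKernel p.1.2 p.2.2 :=
      (measurable_heatKernel (E := E)).comp (g := fun q : ℝ × E => heatKernel q.1 q.2)
        (f := fun p : (ℝ × ℝ) × (E × E) => (p.1.2, p.2.2)) (m2.prodMk m4)
    have h3 : Measurable fun p : (ℝ × ℝ) × (E × E) => secondDiff θ (x - p.2.1) p.2.2 :=
      (continuous_secondDiff hθ).measurable.comp (g := fun q : E × E => secondDiff θ q.1 q.2)
        (f := fun p : (ℝ × ℝ) × (E × E) => (x - p.2.1, p.2.2)) ((m3.const_sub x).prodMk m4)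
    exact ((m1.pow_const _).mul (m2.pow_const _)).mul ((h1.mul h2).mul h3)
  rw [integrable_prod_iff hm.aestronglyMeasurable]
  refine ⟨?_, ?_⟩
  · filter_upwards [ae_prod_Ioi_pos] with p hp
    exact (integrable_heatKernel_heatKernel_secondDiff hp.1 hp.2 hθ hA x).const_mul _
  · refine Integrable.mono' ((integrable_heat_weight hα hα2 hn).const_mul
      (C * (8 * 2 ^ (dim E / 2)))) hm.aestronglyMeasurable.norm.integral_prod_right' ?_
    filter_upwards [ae_prod_Ioi_pos] with p hp
    rw [Real.norm_of_nonneg (integral_nonneg fun _ => norm_nonneg _)]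
    have e : ∀ q : E × E, ‖p.1 ^ (α / 2 - 1) * p.2 ^ (-(α / 2) - 1) *
        (heatKernel p.1 q.1 * heatKernel p.2 q.2 * secondDiff θ (x - q.1) q.2)‖ =
        p.1 ^ (α / 2 - 1) * p.2 ^ (-(α / 2) - 1) *
        |heatKernel p.1 q.1 * heatKernel p.2 q.2 * secondDiff θ (x - q.1) q.2| := by
      intro q
      rw [norm_mul, Real.norm_of_nonneg (mul_nonneg (rpow_nonneg hp.1.le _)
        (rpow_nonneg hp.2.le _)), Real.norm_eq_abs]
    simp_rw [e]
    rw [integral_const_mul, ← rpow_mul_min_one_rpow hp.1, ← rpow_mul_min_one hp.2]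
    have := mul_le_mul_of_nonneg_left
      (integral_abs_heatKernel_heatKernel_secondDiff_le hp.1 hp.2 hθ hi hA hC0 hC hC1 x)
      (mul_nonneg (rpow_nonneg hp.1.le (α / 2 - 1)) (rpow_nonneg hp.2.le (-(α / 2) - 1)))
    linarith

end HeatSecondDiff

section Dilation

theorem min_one_le_rpow {x p : ℝ} (hx : 0 < x) (hp0 : 0 ≤ p) (hp1 : p ≤ 1) : min 1 x ≤ x ^ p := by
  rcases le_total x 1 with h | h
  · rw [min_eq_right h]
    simpa using rpow_le_rpow_of_exponent_ge hx h hp1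
  · rw [min_eq_left h]
    exact one_le_rpow h hp0

variable {g : ℝ → ℝ} {K a m : ℝ}

theorem integrable_dilation (hg : Measurable g) (ha : 0 < a) (ha1 : a < 1) (ham : a < m)
    (hK : 0 ≤ K)
    (hD : ∀ t s, 0 < t → 0 < s → |g (t + s) - g t| ≤ K * (min 1 (t ^ (-m)) * min 1 s)) :
    Integrable (fun p : ℝ × ℝ => p.1⁻¹ * p.2 ^ (-a - 1) * (g ((1 + p.2) * p.1) - g p.1))
      ((volume.restrict (Set.Ioi 0)).prod (volume.restrict (Set.Ioi 0))) := by
  obtain ⟨ε, hε0, hε1, hε2, hε3⟩ : ∃ ε, 0 < ε ∧ ε < a ∧ a + ε < 1 ∧ a + ε < m := by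
    refine ⟨min a (min (1 - a) (m - a)) / 2, ?_, ?_, ?_, ?_⟩
    · have : 0 < min a (min (1 - a) (m - a)) :=
        lt_min ha (lt_min (by linarith) (by linarith))
      linarith
    · have := min_le_left a (min (1 - a) (m - a)); linarith
    · have := (min_le_right a (min (1 - a) (m - a))).trans (min_le_left _ _); linarith
    · have := (min_le_right a (min (1 - a) (m - a))).trans (min_le_right _ _); linarith
  have hI : Integrable (fun p : ℝ × ℝ => K * (
      (min (p.1 ^ (a + ε - 1)) (p.1 ^ (a + ε - 1 + -m)) +
        min (p.1 ^ (a - ε - 1)) (p.1 ^ (a - ε - 1 + -m))) *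
        min (p.2 ^ (ε - 1)) (p.2 ^ (-ε - 1))))
      ((volume.restrict (Set.Ioi 0)).prod (volume.restrict (Set.Ioi 0))) :=
    (Integrable.mul_prod ((integrableOn_min_rpow (by linarith) (by linarith)).add
      (integrableOn_min_rpow (by linarith) (by linarith)))
      (integrableOn_min_rpow (by linarith) (by linarith))).const_mul K
  refine hI.mono' (Measurable.aestronglyMeasurable ?_) ?_
  · have h1 : Measurable fun p : ℝ × ℝ => g ((1 + p.2) * p.1) := hg.comp (by fun_prop)
    have h2 : Measurable fun p : ℝ × ℝ => g p.1 := hg.comp measurable_fst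
    exact ((measurable_fst.inv).mul (measurable_snd.pow_const _)).mul (h1.sub h2)
  · filter_upwards [ae_prod_Ioi_pos] with p hp
    obtain ⟨t, s⟩ := p
    obtain ⟨ht, hs⟩ : 0 < t ∧ 0 < s := hp
    simp only
    rw [← rpow_mul_min_one_rpow ht, ← rpow_mul_min_one_rpow ht, norm_mul, Real.norm_eq_abs,
      Real.norm_eq_abs, abs_of_nonneg (by positivity)]
    have h1 := hD t (t * s) ht (by positivity)
    rw [show t + t * s = (1 + s) * t by ring] at h1
    have e1 : t⁻¹ * s ^ (-a - 1) * (t * s) ^ (a + ε) = t ^ (a + ε - 1) * s ^ (ε - 1) := by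
      rw [mul_rpow ht.le hs.le, ← rpow_neg_one t,
        show t ^ (-1 : ℝ) * s ^ (-a - 1) * (t ^ (a + ε) * s ^ (a + ε)) =
          (t ^ (-1 : ℝ) * t ^ (a + ε)) * (s ^ (-a - 1) * s ^ (a + ε)) by ring,
        ← rpow_add ht, ← rpow_add hs]
      ring_nf
    have e2 : t⁻¹ * s ^ (-a - 1) * (t * s) ^ (a - ε) = t ^ (a - ε - 1) * s ^ (-ε - 1) := by
      rw [mul_rpow ht.le hs.le, ← rpow_neg_one t,
        show t ^ (-1 : ℝ) * s ^ (-a - 1) * (t ^ (a - ε) * s ^ (a - ε)) =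
          (t ^ (-1 : ℝ) * t ^ (a - ε)) * (s ^ (-a - 1) * s ^ (a - ε)) by ring,
        ← rpow_add ht, ← rpow_add hs]
      ring_nf
    have h2 : t⁻¹ * s ^ (-a - 1) * min 1 (t * s) ≤
        (t ^ (a + ε - 1) + t ^ (a - ε - 1)) * min (s ^ (ε - 1)) (s ^ (-ε - 1)) := by
      have b1 : t⁻¹ * s ^ (-a - 1) * min 1 (t * s) ≤ t ^ (a + ε - 1) * s ^ (ε - 1) := by
        rw [← e1]
        exact mul_le_mul_of_nonneg_left
          (min_one_le_rpow (by positivity) (by linarith) (by linarith)) (by positivity)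
      have b2 : t⁻¹ * s ^ (-a - 1) * min 1 (t * s) ≤ t ^ (a - ε - 1) * s ^ (-ε - 1) := by
        rw [← e2]
        exact mul_le_mul_of_nonneg_left
          (min_one_le_rpow (by positivity) (by linarith) (by linarith)) (by positivity)
      have c1 : 0 ≤ t ^ (a + ε - 1) := by positivity
      have c2 : 0 ≤ t ^ (a - ε - 1) := by positivity
      rw [mul_min_of_nonneg (s ^ (ε - 1)) _ (by positivity)]
      refine le_min (b1.trans ?_) (b2.trans ?_)
      · exact mul_le_mul_of_nonneg_right (by linarith) (by positivity)
      · exact mul_le_mul_of_nonneg_right (by linarith) (by positivity)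
    calc t⁻¹ * s ^ (-a - 1) * |g ((1 + s) * t) - g t|
        ≤ t⁻¹ * s ^ (-a - 1) * (K * (min 1 (t ^ (-m)) * min 1 (t * s))) :=
          mul_le_mul_of_nonneg_left h1 (by positivity)
      _ = K * min 1 (t ^ (-m)) * (t⁻¹ * s ^ (-a - 1) * min 1 (t * s)) := by ring
      _ ≤ K * min 1 (t ^ (-m)) * ((t ^ (a + ε - 1) + t ^ (a - ε - 1)) *
          min (s ^ (ε - 1)) (s ^ (-ε - 1))) := mul_le_mul_of_nonneg_left h2 (by positivity)
      _ = _ := by ring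

theorem integral_dilation (hg : Measurable g) (ha : 0 < a) (ha1 : a < 1) (ham : a < m)
    (hK : 0 ≤ K) (hb : ∀ t, 0 < t → |g t| ≤ K)
    (hD : ∀ t s, 0 < t → 0 < s → |g (t + s) - g t| ≤ K * (min 1 (t ^ (-m)) * min 1 s))
    {L : ℝ} (h0 : Tendsto g (𝓝[>] 0) (𝓝 L)) (hinf : Tendsto g atTop (𝓝 0)) :
    ∫ t in Set.Ioi (0 : ℝ), ∫ s in Set.Ioi (0 : ℝ),
      t ^ (a - 1) * s ^ (-a - 1) * (g (t + s) - g t) =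
      -L * ∫ s in Set.Ioi (0 : ℝ), s ^ (-a - 1) * log (1 + s) := by
  have hI := integrable_dilation hg ha ha1 ham hK hD
  have hsub : ∀ t ∈ Set.Ioi (0 : ℝ), ∫ s in Set.Ioi (0 : ℝ),
      t ^ (a - 1) * s ^ (-a - 1) * (g (t + s) - g t) =
      ∫ s in Set.Ioi (0 : ℝ), t⁻¹ * s ^ (-a - 1) * (g ((1 + s) * t) - g t) := by
    intro t ht
    have ht : 0 < t := ht
    have := integral_comp_mul_left_Ioi'
      (fun s => t ^ (a - 1) * s ^ (-a - 1) * (g (t + s) - g t)) 0 ht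
    rw [mul_zero] at this
    rw [← this, smul_eq_mul, ← integral_const_mul]
    refine setIntegral_congr_fun measurableSet_Ioi fun s hs => ?_
    have hs : 0 < s := hs
    rw [show t + t * s = (1 + s) * t by ring, mul_rpow ht.le hs.le,
      show t * (t ^ (a - 1) * (t ^ (-a - 1) * s ^ (-a - 1)) * (g ((1 + s) * t) - g t)) =
        (t ^ (1 : ℝ) * t ^ (a - 1) * t ^ (-a - 1)) * s ^ (-a - 1) * (g ((1 + s) * t) - g t) by
        rw [rpow_one]; ring, ← rpow_add ht, ← rpow_add ht, ← rpow_neg_one t]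
    ring_nf
  rw [setIntegral_congr_fun measurableSet_Ioi hsub, integral_integral_swap (by exact hI),
    ← integral_const_mul]
  have hloc : LocallyIntegrableOn g (Set.Ioi 0) := by
    rw [locallyIntegrableOn_iff isOpen_Ioi.isLocallyClosed]
    intro k hk hkc
    refine Measure.integrableOn_of_bounded (M := K) hkc.measure_lt_top.ne
      hg.aestronglyMeasurable ?_
    filter_upwards [ae_restrict_mem hkc.measurableSet] with t ht
    exact hb t (hk ht)
  refine integral_congr_ae ?_
  filter_upwards [hI.prod_left_ae, ae_restrict_mem measurableSet_Ioi] with s h1 hs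
  have hs : 0 < s := hs
  have hne : s ^ (-a - 1) ≠ 0 := by positivity
  have h2 : IntegrableOn (fun x => x⁻¹ • (g ((1 + s) * x) - g (1 * x))) (Set.Ioi 0) := by
    refine (Integrable.const_mul h1 (s ^ (-a - 1))⁻¹).congr (ae_of_all _ fun t => ?_)
    simp only [smul_eq_mul, one_mul]
    field_simp
  have h3 := Frullani.integral_Ioi_eq hloc (by positivity : 0 < 1 + s) one_pos h0 hinf h2
  have h4 : ∀ t : ℝ, t⁻¹ * s ^ (-a - 1) * (g ((1 + s) * t) - g t) =
      s ^ (-a - 1) * (t⁻¹ • (g ((1 + s) * t) - g (1 * t))) := by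
    intro t; simp only [smul_eq_mul, one_mul]; ring
  simp only [h4]
  rw [integral_const_mul, h3, one_div, log_inv]
  simp only [smul_eq_mul]; ring

theorem integral_rpow_mul_log_pos (ha : 0 < a) (ha1 : a < 1) :
    0 < ∫ s in Set.Ioi (0 : ℝ), s ^ (-a - 1) * log (1 + s) := by
  have hle : ∀ s : ℝ, 0 < s → log (1 + s) ≤ (1 + 2 ^ (a / 2) * (2 / a)) * min s (s ^ (a / 2)) := by
    intro s hs
    have hc : 0 ≤ 2 ^ (a / 2) * (2 / a) := by positivity
    rcases le_total s 1 with h | h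
    · have : s ≤ s ^ (a / 2) := by
        simpa using rpow_le_rpow_of_exponent_ge hs h (by linarith : a / 2 ≤ 1)
      rw [min_eq_left this]
      have := log_le_sub_one_of_pos (by positivity : 0 < 1 + s)
      nlinarith
    · have : s ^ (a / 2) ≤ s := by
        simpa using rpow_le_rpow_of_exponent_le h (by linarith : a / 2 ≤ 1)
      rw [min_eq_right this]
      have h1 := log_le_rpow_div (by positivity : 0 ≤ 1 + s) (by positivity : 0 < a / 2)
      have h2 : (1 + s) ^ (a / 2) ≤ 2 ^ (a / 2) * s ^ (a / 2) := by
        rw [← mul_rpow (by norm_num) hs.le]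
        exact rpow_le_rpow (by positivity) (by linarith) (by positivity)
      have h3 : (1 + s) ^ (a / 2) / (a / 2) ≤ 2 ^ (a / 2) * (2 / a) * s ^ (a / 2) := by
        rw [div_le_iff₀ (by positivity)]
        refine h2.trans_eq ?_
        field_simp
      have : 0 ≤ s ^ (a / 2) := by positivity
      nlinarith
  have h_swap : IntegrableOn (fun s : ℝ => s ^ (-a - 1) * log (1 + s)) (Set.Ioi 0) := by
    refine Integrable.mono' ((integrableOn_min_rpow (p := -a) (q := -(a / 2) - 1) (by linarith)
      (by linarith)).const_mul (1 + 2 ^ (a / 2) * (2 / a)))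
      (Measurable.aestronglyMeasurable (by fun_prop)) ?_
    filter_upwards [ae_restrict_mem measurableSet_Ioi] with s hs
    have hs : 0 < s := hs
    have hl : 0 ≤ log (1 + s) := log_nonneg (by linarith)
    rw [Real.norm_of_nonneg (by positivity)]
    refine (mul_le_mul_of_nonneg_left (hle s hs) (by positivity)).trans_eq ?_
    have e1 : s ^ (-a) = s ^ (-a - 1) * s := by
      conv_rhs => rw [← rpow_one s, ← rpow_mul hs.le, one_mul, ← rpow_add hs]
      ring_nf
    have e2 : s ^ (-(a / 2) - 1) = s ^ (-a - 1) * s ^ (a / 2) := by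
      rw [← rpow_add hs]; ring_nf
    rw [e1, e2, ← mul_min_of_nonneg _ _ (by positivity)]; ring
  rw [setIntegral_pos_iff_support_of_nonneg_ae ?_ h_swap]
  · have : Set.Ioi (0 : ℝ) ⊆ (Function.support fun s : ℝ => s ^ (-a - 1) * log (1 + s)) ∩
        Set.Ioi 0 := fun s hs => by
      have hs' : 0 < s := hs
      refine ⟨?_, hs⟩
      have : 0 < log (1 + s) := log_pos (by linarith)
      exact (by positivity : (0 : ℝ) < s ^ (-a - 1) * log (1 + s)).ne'
    refine lt_of_lt_of_le ?_ (measure_mono this)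
    simp
  · filter_upwards [ae_restrict_mem measurableSet_Ioi] with s hs
    have hs : 0 < s := hs
    have hl : 0 ≤ log (1 + s) := log_nonneg (by linarith)
    simp only [Pi.zero_apply]
    positivity

end Dilation

section FundamentalSolution

variable {E : Type*} [NormedAddCommGroup E] [InnerProductSpace ℝ E] [FiniteDimensional ℝ E]
  [MeasurableSpace E] [BorelSpace E]

/-- The (unnormalised) Riesz kernel. -/
def rieszKer (α : ℝ) (x : E) : ℝ := ‖x‖ ^ (-(dim E - α))

/-- The (unnormalised) fractional Laplacian as a singular integral. -/
def levyOp (α : ℝ) (θ : E → ℝ) (x : E) : ℝ := ∫ z, secondDiff θ x z / ‖z‖ ^ (dim E + α)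

theorem rieszKer_nonneg (α : ℝ) (x : E) : 0 ≤ rieszKer α x := by unfold rieszKer; positivity

theorem rieszKer_neg (α : ℝ) (x : E) : rieszKer α (-x) = rieszKer α x := by simp [rieszKer]

theorem measurable_rieszKer (α : ℝ) : Measurable (rieszKer α : E → ℝ) := by
  unfold rieszKer; fun_prop

theorem integral_rpow_mul_heatKernel_riesz {α : ℝ} (hn : α < dim E) {x : E} (hx : x ≠ 0) :
    ∫ t in Set.Ioi (0 : ℝ), t ^ (α / 2 - 1) * heatKernel t x =
      heatConst E (α / 2) * rieszKer α x := by
  rw [integral_rpow_mul_heatKernel (by linarith) hx]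
  unfold rieszKer
  ring_nf

theorem integral_rpow_mul_heatKernel_levy {α : ℝ} (hα : 0 < α) {x : E} (hx : x ≠ 0) :
    ∫ t in Set.Ioi (0 : ℝ), t ^ (-(α / 2) - 1) * heatKernel t x =
      heatConst E (-(α / 2)) / ‖x‖ ^ (dim E + α) := by
  have : 0 ≤ dim E := by positivity
  rw [integral_rpow_mul_heatKernel (by linarith) hx, div_eq_mul_inv (heatConst E _) (‖x‖ ^ _),
    ← rpow_neg (norm_nonneg _)]
  congr 2
  ring

theorem ae_ne_zero (h : 0 < dim E) : ∀ᵐ x : E, x ≠ 0 := by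
  have : Nontrivial E := by
    have : 0 < Module.finrank ℝ E := by exact_mod_cast h
    exact Module.finrank_pos_iff.1 this
  exact Measure.ae_ne volume 0

theorem integral_heat_secondDiff {α : ℝ} (hα : 0 < α) (hn : α < dim E) (θ : E → ℝ)
    (x : E) {q : E × E} (h1 : q.1 ≠ 0) (h2 : q.2 ≠ 0) :
    ∫ p : ℝ × ℝ, p.1 ^ (α / 2 - 1) * p.2 ^ (-(α / 2) - 1) *
        (heatKernel p.1 q.1 * heatKernel p.2 q.2 * secondDiff θ (x - q.1) q.2)
      ∂((volume.restrict (Set.Ioi 0)).prod (volume.restrict (Set.Ioi 0))) =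
    heatConst E (α / 2) * heatConst E (-(α / 2)) *
      (rieszKer α q.1 * (secondDiff θ (x - q.1) q.2 / ‖q.2‖ ^ (dim E + α))) := by
  have e : ∀ p : ℝ × ℝ, p.1 ^ (α / 2 - 1) * p.2 ^ (-(α / 2) - 1) *
        (heatKernel p.1 q.1 * heatKernel p.2 q.2 * secondDiff θ (x - q.1) q.2) =
      secondDiff θ (x - q.1) q.2 * ((p.1 ^ (α / 2 - 1) * heatKernel p.1 q.1) *
        (p.2 ^ (-(α / 2) - 1) * heatKernel p.2 q.2)) := fun p => by ring
  simp_rw [e]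
  rw [integral_const_mul, integral_prod_mul (fun t : ℝ => t ^ (α / 2 - 1) * heatKernel t q.1)
    (fun t : ℝ => t ^ (-(α / 2) - 1) * heatKernel t q.2),
    integral_rpow_mul_heatKernel_riesz hn h1, integral_rpow_mul_heatKernel_levy hα h2]
  ring

theorem ae_prod_ne_zero (h : 0 < dim E) :
    ∀ᵐ q : E × E ∂(volume.prod volume), q.1 ≠ 0 ∧ q.2 ≠ 0 := by
  refine Filter.Eventually.and ?_ ?_
  · exact Measure.quasiMeasurePreserving_fst.ae (ae_ne_zero h)
  · exact Measure.quasiMeasurePreserving_snd.ae (ae_ne_zero h)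

theorem integrable_riesz_levy {α : ℝ} (hα : 0 < α) (hα2 : α < 2) (hn : α < dim E)
    {θ : E → ℝ} (hθ : ContDiff ℝ (⊤ : ℕ∞) θ) (hc : HasCompactSupport θ) (x : E) :
    Integrable (fun q : E × E => rieszKer α q.1 *
      (secondDiff θ (x - q.1) q.2 / ‖q.2‖ ^ (dim E + α))) (volume.prod volume) := by
  obtain ⟨A, hA⟩ := hc.exists_bound_of_continuous hθ.continuous
  obtain ⟨C, hC0, hC, hC1⟩ := exists_secondDiff_bound hθ hc
  have h := (integrable_heat_secondDiff hα hα2 hn hθ.continuous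
    (hθ.continuous.integrable_of_hasCompactSupport hc) hA hC0 hC hC1 x).integral_prod_right
  have c1 : 0 < heatConst E (α / 2) := heatConst_pos (by linarith)
  have c2 : 0 < heatConst E (-(α / 2)) := heatConst_pos (by linarith)
  refine (h.const_mul (heatConst E (α / 2) * heatConst E (-(α / 2)))⁻¹).congr ?_
  filter_upwards [ae_prod_ne_zero (hα.trans hn)] with q hq
  rw [integral_heat_secondDiff hα hn θ x hq.1 hq.2, inv_mul_cancel_left₀ (by positivity)]

theorem measurable_heatOp_time {θ : E → ℝ} (hθ : Measurable θ) (x : E) :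
    Measurable (fun t => heatOp t θ x) := by
  have : StronglyMeasurable (fun p : ℝ × E => heatKernel p.1 p.2 * θ (x - p.2)) :=
    ((measurable_heatKernel (E := E)).mul
      (hθ.comp (measurable_snd.const_sub x))).stronglyMeasurable
  exact (this.integral_prod_right (ν := volume)).measurable

theorem exists_integral_rieszKer_mul_levyOp {α : ℝ} (hα : 0 < α) (hα2 : α < 2)
    (hn : α < dim E) : ∃ κ : ℝ, 0 < κ ∧ ∀ θ : E → ℝ, ContDiff ℝ (⊤ : ℕ∞) θ →
      HasCompactSupport θ → ∀ x, ∫ y, rieszKer α y * levyOp α θ (x - y) = -κ * θ x := by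
  have c1 : 0 < heatConst E (α / 2) := heatConst_pos (by linarith)
  have c2 : 0 < heatConst E (-(α / 2)) := heatConst_pos (by linarith)
  have hJ := integral_rpow_mul_log_pos (by linarith : 0 < α / 2) (by linarith)
  set J := ∫ s in Set.Ioi (0 : ℝ), s ^ (-(α / 2) - 1) * log (1 + s) with hJdef
  refine ⟨2 * J / (heatConst E (α / 2) * heatConst E (-(α / 2))), by positivity,
    fun θ hθ hc x => ?_⟩
  obtain ⟨A, hA⟩ := hc.exists_bound_of_continuous hθ.continuous
  obtain ⟨C, hC0, hC, hC1⟩ := exists_secondDiff_bound hθ hc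
  have hi : Integrable θ := hθ.continuous.integrable_of_hasCompactSupport hc
  have hI := integrable_heat_secondDiff hα hα2 hn hθ.continuous hi hA hC0 hC hC1 x
  set D := C * (8 * 2 ^ (dim E / 2)) with hDdef
  have hD0 : 0 ≤ D := by positivity
  set B := max A (∫ x, |θ x|) with hB
  have hA0 : 0 ≤ A := (norm_nonneg _).trans (hA 0)
  have hB0 : 0 ≤ B := hA0.trans (le_max_left _ _)
  have hg : ∀ t, 0 < t → |heatOp t θ x| ≤ B * min 1 (t ^ (-(dim E) / 2)) := fun t ht =>
    abs_heatOp_le ht hi (fun x => (hA x).trans (le_max_left _ _)) (le_max_right _ _) x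
  have key := integral_dilation (g := fun t => heatOp t θ x) (K := max D B) (m := dim E / 2)
    (a := α / 2) (L := θ x)
    (measurable_heatOp_time hθ.continuous.measurable x) (by linarith) (by linarith)
    (by linarith) (hD0.trans (le_max_left _ _)) (fun t ht => ?_) (fun t s ht hs => ?_) ?_ ?_
  · rw [← hJdef] at key
    have h1 : ∫ y, rieszKer α y * levyOp α θ (x - y) =
        ∫ q : E × E, rieszKer α q.1 * (secondDiff θ (x - q.1) q.2 / ‖q.2‖ ^ (dim E + α))
          ∂(volume.prod volume) := by
      rw [integral_prod _ (integrable_riesz_levy hα hα2 hn hθ hc x)]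
      simp_rw [integral_const_mul]
      rfl
    have h2 : heatConst E (α / 2) * heatConst E (-(α / 2)) *
        ∫ q : E × E, rieszKer α q.1 * (secondDiff θ (x - q.1) q.2 / ‖q.2‖ ^ (dim E + α))
          ∂(volume.prod volume) = 2 * (-θ x * J) := by
      rw [← integral_const_mul, ← key, ← integral_const_mul]
      have h3 : ∫ q : E × E, heatConst E (α / 2) * heatConst E (-(α / 2)) *
          (rieszKer α q.1 * (secondDiff θ (x - q.1) q.2 / ‖q.2‖ ^ (dim E + α)))
            ∂(volume.prod volume) = ∫ q : E × E, ∫ p : ℝ × ℝ,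
          p.1 ^ (α / 2 - 1) * p.2 ^ (-(α / 2) - 1) *
            (heatKernel p.1 q.1 * heatKernel p.2 q.2 * secondDiff θ (x - q.1) q.2)
          ∂((volume.restrict (Set.Ioi 0)).prod (volume.restrict (Set.Ioi 0)))
          ∂(volume.prod volume) := by
        refine integral_congr_ae ?_
        filter_upwards [ae_prod_ne_zero (hα.trans hn)] with q hq
        rw [integral_heat_secondDiff hα hn θ x hq.1 hq.2]
      rw [h3, ← integral_integral_swap (by exact hI)]
      have h4 : ∀ᵐ p : ℝ × ℝ ∂((volume.restrict (Set.Ioi 0)).prod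
          (volume.restrict (Set.Ioi 0))), ∫ q : E × E, p.1 ^ (α / 2 - 1) * p.2 ^ (-(α / 2) - 1) *
            (heatKernel p.1 q.1 * heatKernel p.2 q.2 * secondDiff θ (x - q.1) q.2)
            ∂(volume.prod volume) = p.1 ^ (α / 2 - 1) * p.2 ^ (-(α / 2) - 1) *
              (2 * (heatOp (p.1 + p.2) θ x - heatOp p.1 θ x)) := by
        filter_upwards [ae_prod_Ioi_pos] with p hp
        rw [integral_const_mul,
          integral_heatKernel_heatKernel_secondDiff hp.1 hp.2 hθ.continuous hi hA x]
      rw [integral_congr_ae h4, integral_prod _ (hI.integral_prod_left.congr h4)]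
      refine integral_congr_ae (ae_of_all _ fun t => ?_)
      simp only
      rw [← integral_const_mul]
      refine integral_congr_ae (ae_of_all _ fun s => ?_)
      simp only; ring
    rw [h1, show -(2 * J / (heatConst E (α / 2) * heatConst E (-(α / 2)))) * θ x =
      (2 * (-θ x * J)) / (heatConst E (α / 2) * heatConst E (-(α / 2))) by ring, ← h2]
    field_simp
  · refine (hg t ht).trans ((mul_le_of_le_one_right hB0 (min_le_left _ _)).trans
      (le_max_right _ _))
  · have := abs_heatOp_add_sub_le ht hs hθ.continuous hi hA hC0 hC hC1 x
    rw [abs_mul, abs_two, neg_div] at this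
    have h0 : 0 ≤ min 1 (t ^ (-(dim E / 2))) * min 1 s := by positivity
    have h1 := mul_le_mul_of_nonneg_right (le_max_left D B) h0
    have h2 := abs_nonneg (heatOp (t + s) θ x - heatOp t θ x)
    linarith
  · rw [tendsto_iff_norm_sub_tendsto_zero]
    have h1 : Tendsto (fun s : ℝ => D * min 1 s) (𝓝[>] 0) (𝓝 0) := by
      have : Continuous fun s : ℝ => D * min 1 s := by fun_prop
      simpa using (this.tendsto 0).mono_left nhdsWithin_le_nhds
    refine squeeze_zero' (Eventually.of_forall fun _ => norm_nonneg _) ?_ h1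
    filter_upwards [self_mem_nhdsWithin] with s hs
    exact abs_heatOp_sub_self_le hs hi hC hC0 x
  · have h1 : Tendsto (fun t : ℝ => B * t ^ (-(dim E / 2))) atTop (𝓝 0) := by
      simpa using (tendsto_rpow_neg_atTop (by linarith : 0 < dim E / 2)).const_mul B
    refine squeeze_zero_norm' ?_ h1
    filter_upwards [eventually_gt_atTop 0] with t ht
    refine (hg t ht).trans ?_
    rw [neg_div]
    exact mul_le_mul_of_nonneg_left (min_le_right _ _) hB0

end FundamentalSolution

section Potential

variable {E : Type*} [NormedAddCommGroup E] [InnerProductSpace ℝ E] [FiniteDimensional ℝ E]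
  [MeasurableSpace E] [BorelSpace E]

/-- Bounded measurable functions vanishing outside a ball. -/
structure BddCompact (f : E → ℝ) : Prop where
  measurable : Measurable f
  bdd : ∃ A, ∀ x, |f x| ≤ A
  supp : ∃ R, ∀ x, R < ‖x‖ → f x = 0

theorem BddCompact.integrable {f : E → ℝ} (hf : BddCompact f) : Integrable f := by
  obtain ⟨A, hA⟩ := hf.bdd
  obtain ⟨R, hR⟩ := hf.supp
  have h1 : IntegrableOn f (Metric.closedBall 0 R) :=
    Measure.integrableOn_of_bounded (M := A) measure_closedBall_lt_top.ne
      hf.measurable.aestronglyMeasurable (ae_of_all _ hA)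
  refine (integrableOn_iff_integrable_of_support_subset fun x hx => ?_).1 h1
  by_contra h
  exact hx (hR x (by simpa using h))

theorem BddCompact.exists_bound {f : E → ℝ} (hf : BddCompact f) :
    ∃ A, 0 ≤ A ∧ (∀ x, |f x| ≤ A) ∧ ∫ x, |f x| ≤ A := by
  obtain ⟨A, hA⟩ := hf.bdd
  exact ⟨max A (∫ x, |f x|), ((abs_nonneg _).trans (hA 0)).trans (le_max_left _ _),
    fun x => (hA x).trans (le_max_left _ _), le_max_right _ _⟩

theorem BddCompact.abs {f : E → ℝ} (hf : BddCompact f) : BddCompact (fun x => |f x|) :=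
  ⟨hf.measurable.abs, by simpa using hf.bdd, by simpa using hf.supp⟩

theorem BddCompact.mul_bdd {f g : E → ℝ} (hf : BddCompact f) (hg : Measurable g) {B : ℝ}
    (hB : ∀ x, |g x| ≤ B) : BddCompact (fun x => f x * g x) := by
  obtain ⟨A, hA⟩ := hf.bdd
  obtain ⟨R, hR⟩ := hf.supp
  refine ⟨hf.measurable.mul hg, ⟨A * B, fun x => ?_⟩, ⟨R, fun x hx => by simp [hR x hx]⟩⟩
  rw [abs_mul]
  exact mul_le_mul (hA x) (hB x) (abs_nonneg _) ((abs_nonneg _).trans (hA x))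

theorem BddCompact.const_mul {f : E → ℝ} (hf : BddCompact f) (c : ℝ) :
    BddCompact (fun x => c * f x) := by
  simpa [mul_comm] using hf.mul_bdd (g := fun _ => c) measurable_const (B := |c|) fun _ => le_rfl

theorem BddCompact.sub {f g : E → ℝ} (hf : BddCompact f) (hg : BddCompact g) :
    BddCompact (fun x => f x - g x) := by
  obtain ⟨A, hA⟩ := hf.bdd
  obtain ⟨R, hR⟩ := hf.supp
  obtain ⟨B, hB⟩ := hg.bdd
  obtain ⟨S, hS⟩ := hg.supp
  refine ⟨hf.measurable.sub hg.measurable, ⟨A + B, fun x => ?_⟩, ⟨max R S, fun x hx => ?_⟩⟩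
  · exact (abs_sub _ _).trans (add_le_add (hA x) (hB x))
  · rw [hR x ((le_max_left _ _).trans_lt hx), hS x ((le_max_right _ _).trans_lt hx), sub_zero]

/-- The (unnormalised) Riesz potential. -/
def pot (α : ℝ) (f : E → ℝ) (x : E) : ℝ := ∫ y, rieszKer α (x - y) * f y

theorem integrable_heat_pot {α : ℝ} (hα : 0 < α) (hn : α < dim E) {f : E → ℝ}
    (hf : BddCompact f) (x : E) :
    Integrable (fun p : ℝ × E => p.1 ^ (α / 2 - 1) * (heatKernel p.1 (x - p.2) * f p.2))
      ((volume.restrict (Set.Ioi 0)).prod volume) := by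
  obtain ⟨A, hA0, hA, hA1⟩ := hf.exists_bound
  have hm : Measurable (fun p : ℝ × E =>
      p.1 ^ (α / 2 - 1) * (heatKernel p.1 (x - p.2) * f p.2)) :=
    (measurable_fst.pow_const _).mul
      (((measurable_heatKernel (E := E)).comp (g := fun q : ℝ × E => heatKernel q.1 q.2)
        (f := fun p : ℝ × E => (p.1, x - p.2))
        (measurable_fst.prodMk (measurable_snd.const_sub x))).mul
        (hf.measurable.comp measurable_snd))
  have hi : ∀ t : ℝ, 0 < t → Integrable (fun y => heatKernel t (x - y) * f y) := fun t ht => by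
    simpa using (integrable_heatKernel_mul ht hf.integrable x).comp_sub_left x
  rw [integrable_prod_iff hm.aestronglyMeasurable]
  refine ⟨?_, ?_⟩
  · filter_upwards [ae_restrict_mem measurableSet_Ioi] with t ht
    exact (hi t ht).const_mul _
  · refine Integrable.mono' ((integrableOn_min_rpow (p := α / 2 - 1)
      (q := α / 2 - 1 + -(dim E) / 2) (by linarith) (by linarith)).const_mul A)
      hm.aestronglyMeasurable.norm.integral_prod_right' ?_
    filter_upwards [ae_restrict_mem measurableSet_Ioi] with t ht
    have ht : 0 < t := ht
    rw [Real.norm_of_nonneg (integral_nonneg fun _ => norm_nonneg _)]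
    have e : ∀ y : E, ‖t ^ (α / 2 - 1) * (heatKernel t (x - y) * f y)‖ =
        t ^ (α / 2 - 1) * (heatKernel t (x - y) * |f y|) := by
      intro y
      rw [norm_mul, norm_mul, Real.norm_of_nonneg (by positivity),
        Real.norm_of_nonneg (heatKernel_nonneg ht _), Real.norm_eq_abs]
    simp_rw [e]
    rw [integral_const_mul, ← heatOp_eq_integral_sub (t := t) (fun y => |f y|) x,
      ← rpow_mul_min_one_rpow ht]
    have := integral_heatKernel_mul_abs_le ht hf.integrable hA hA1 x
    refine (mul_le_mul_of_nonneg_left this (by positivity)).trans_eq (by ring)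

theorem ae_integral_heat_pot {α : ℝ} (hα : 0 < α) (hn : α < dim E) (f : E → ℝ) (x : E) :
    ∀ᵐ y : E, ∫ t in Set.Ioi (0 : ℝ), t ^ (α / 2 - 1) * (heatKernel t (x - y) * f y) =
      heatConst E (α / 2) * (rieszKer α (x - y) * f y) := by
  have : Nontrivial E := by
    have : 0 < Module.finrank ℝ E := by exact_mod_cast hα.trans hn
    exact Module.finrank_pos_iff.1 this
  filter_upwards [Measure.ae_ne volume x] with y hy
  simp_rw [← mul_assoc]
  rw [integral_mul_const, integral_rpow_mul_heatKernel_riesz hn (sub_ne_zero.2 hy.symm)]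

theorem integrable_rieszKer_mul {α : ℝ} (hα : 0 < α) (hn : α < dim E) {f : E → ℝ}
    (hf : BddCompact f) (x : E) : Integrable (fun y => rieszKer α (x - y) * f y) := by
  have c1 : 0 < heatConst E (α / 2) := heatConst_pos (by linarith)
  refine ((integrable_heat_pot hα hn hf x).integral_prod_right.const_mul
    (heatConst E (α / 2))⁻¹).congr ?_
  filter_upwards [ae_integral_heat_pot hα hn f x] with y hy
  rw [hy, inv_mul_cancel_left₀ c1.ne']

theorem pot_eq_integral_heatOp {α : ℝ} (hα : 0 < α) (hn : α < dim E) {f : E → ℝ}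
    (hf : BddCompact f) (x : E) : heatConst E (α / 2) * pot α f x =
      ∫ t in Set.Ioi (0 : ℝ), t ^ (α / 2 - 1) * heatOp t f x := by
  unfold pot
  rw [← integral_const_mul, ← integral_congr_ae (ae_integral_heat_pot hα hn f x),
    ← integral_integral_swap (by exact integrable_heat_pot hα hn hf x)]
  simp_rw [integral_const_mul, heatOp_eq_integral_sub]

theorem abs_rpow_mul_heatOp_le {α : ℝ} {f : E → ℝ} (hf : BddCompact f) {A : ℝ}
    (hA : ∀ x, |f x| ≤ A) (hA1 : ∫ x, |f x| ≤ A) {t : ℝ} (ht : 0 < t) (x : E) :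
    ‖t ^ (α / 2 - 1) * heatOp t f x‖ ≤
      A * min (t ^ (α / 2 - 1)) (t ^ (α / 2 - 1 + -(dim E) / 2)) := by
  rw [norm_mul, Real.norm_of_nonneg (by positivity), Real.norm_eq_abs,
    ← rpow_mul_min_one_rpow ht]
  refine (mul_le_mul_of_nonneg_left (abs_heatOp_le ht hf.integrable hA hA1 x)
    (by positivity)).trans_eq (by ring)

theorem exists_abs_pot_le {α : ℝ} (hα : 0 < α) (hn : α < dim E) {f : E → ℝ}
    (hf : BddCompact f) : ∃ C, 0 ≤ C ∧ ∀ x, |pot α f x| ≤ C := by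
  obtain ⟨A, hA0, hA, hA1⟩ := hf.exists_bound
  have c1 : 0 < heatConst E (α / 2) := heatConst_pos (by linarith)
  set J := ∫ t in Set.Ioi (0 : ℝ), A * min (t ^ (α / 2 - 1)) (t ^ (α / 2 - 1 + -(dim E) / 2))
  have h : ∀ x, |pot α f x| ≤ (heatConst E (α / 2))⁻¹ * J := by
    intro x
    have h1 : ‖∫ t in Set.Ioi (0 : ℝ), t ^ (α / 2 - 1) * heatOp t f x‖ ≤ J := by
      refine norm_integral_le_of_norm_le ((integrableOn_min_rpow (by linarith)
        (by linarith)).const_mul A) ?_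
      filter_upwards [ae_restrict_mem measurableSet_Ioi] with t ht
      exact abs_rpow_mul_heatOp_le hf hA hA1 ht x
    rw [← pot_eq_integral_heatOp hα hn hf, norm_mul, Real.norm_of_nonneg c1.le,
      Real.norm_eq_abs] at h1
    rw [inv_mul_eq_div, le_div_iff₀ c1]
    linarith
  exact ⟨_, (abs_nonneg _).trans (h 0), h⟩

theorem continuous_pot {α : ℝ} (hα : 0 < α) (hn : α < dim E) {f : E → ℝ}
    (hf : BddCompact f) : Continuous (pot α f) := by
  obtain ⟨A, hA0, hA, hA1⟩ := hf.exists_bound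
  have c1 : 0 < heatConst E (α / 2) := heatConst_pos (by linarith)
  have e : pot α f = fun x => (heatConst E (α / 2))⁻¹ *
      ∫ t in Set.Ioi (0 : ℝ), t ^ (α / 2 - 1) * heatOp t f x := by
    funext x
    rw [← pot_eq_integral_heatOp hα hn hf, inv_mul_cancel_left₀ c1.ne']
  rw [e]
  refine continuous_const.mul (continuous_of_dominated (bound := fun t =>
    A * min (t ^ (α / 2 - 1)) (t ^ (α / 2 - 1 + -(dim E) / 2))) (fun x => ?_) (fun x => ?_)
    ((integrableOn_min_rpow (by linarith) (by linarith)).const_mul A) ?_)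
  · exact ((measurable_id.pow_const _).mul
      (measurable_heatOp_time hf.measurable x)).aestronglyMeasurable
  · filter_upwards [ae_restrict_mem measurableSet_Ioi] with t ht
    exact abs_rpow_mul_heatOp_le hf hA hA1 ht x
  · filter_upwards [ae_restrict_mem measurableSet_Ioi] with t ht
    exact continuous_const.mul (continuous_heatOp ht hf.integrable)

theorem tendsto_pot {α : ℝ} (hn : α < dim E) {f : E → ℝ}
    (hf : BddCompact f) : Tendsto (pot α f) (cocompact E) (𝓝 0) := by
  obtain ⟨R, hR⟩ := hf.supp
  have h1 : Tendsto (fun x : E => (‖x‖ - R) ^ (-(dim E - α)) * ∫ y, |f y|) (cocompact E) (𝓝 0) := by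
    have h2 : Tendsto (fun x : E => ‖x‖ - R) (cocompact E) atTop := by
      simpa [sub_eq_add_neg] using
        tendsto_atTop_add_const_right _ (-R) (tendsto_norm_cocompact_atTop (E := E))
    simpa using ((tendsto_rpow_neg_atTop (by linarith : 0 < dim E - α)).comp h2).mul_const
      (∫ y, |f y|)
  refine squeeze_zero_norm' ?_ h1
  have h3 : ∀ᶠ x : E in cocompact E, R < ‖x‖ :=
    (tendsto_norm_cocompact_atTop (E := E)).eventually_gt_atTop R
  filter_upwards [h3] with x hx
  unfold pot
  rw [← integral_const_mul]
  refine norm_integral_le_of_norm_le (hf.integrable.abs.const_mul _) (ae_of_all _ fun y => ?_)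
  rw [norm_mul, Real.norm_of_nonneg (rieszKer_nonneg _ _), Real.norm_eq_abs]
  by_cases hy : R < ‖y‖
  · simp [hR y hy]
  · refine mul_le_mul_of_nonneg_right ?_ (abs_nonneg _)
    refine rpow_le_rpow_of_nonpos (by linarith) ?_ (by linarith)
    have := norm_sub_norm_le x y
    linarith [not_lt.1 hy]

theorem pot_sub {α : ℝ} (hα : 0 < α) (hn : α < dim E) {f g : E → ℝ}
    (hf : BddCompact f) (hg : BddCompact g) (x : E) :
    pot α (fun y => f y - g y) x = pot α f x - pot α g x := by
  unfold pot
  rw [← integral_sub (integrable_rieszKer_mul hα hn hf x) (integrable_rieszKer_mul hα hn hg x)]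
  simp_rw [mul_sub]

theorem pot_const_mul (α c : ℝ) (f : E → ℝ) (x : E) :
    pot α (fun y => c * f y) x = c * pot α f x := by
  unfold pot
  rw [← integral_const_mul]
  congr 1; ext y; ring

theorem pot_mono {α : ℝ} (hα : 0 < α) (hn : α < dim E) {f g : E → ℝ}
    (hf : BddCompact f) (hg : BddCompact g) (h : ∀ x, f x ≤ g x) (x : E) :
    pot α f x ≤ pot α g x :=
  integral_mono (integrable_rieszKer_mul hα hn hf x) (integrable_rieszKer_mul hα hn hg x)
    fun y => mul_le_mul_of_nonneg_left (h y) (rieszKer_nonneg _ _)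

theorem pot_nonneg {α : ℝ} {f : E → ℝ} (h : ∀ x, 0 ≤ f x) (x : E) : 0 ≤ pot α f x :=
  integral_nonneg fun y => mul_nonneg (rieszKer_nonneg _ _) (h y)

theorem integrable_mul_pot_prod {α : ℝ} (hα : 0 < α) (hn : α < dim E) {G f : E → ℝ}
    (hG : Integrable G) (hf : BddCompact f) :
    Integrable (fun p : E × E => G p.1 * (rieszKer α (p.1 - p.2) * f p.2))
      (volume.prod volume) := by
  obtain ⟨C, hC0, hC⟩ := exists_abs_pot_le hα hn hf.abs
  have hm : AEStronglyMeasurable (fun p : E × E => G p.1 * (rieszKer α (p.1 - p.2) * f p.2))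
      (volume.prod volume) :=
    hG.aestronglyMeasurable.comp_fst.mul (((measurable_rieszKer α).comp
      (measurable_fst.sub measurable_snd)).mul
        (hf.measurable.comp measurable_snd)).aestronglyMeasurable
  rw [integrable_prod_iff hm]
  refine ⟨ae_of_all _ fun x => (integrable_rieszKer_mul hα hn hf x).const_mul (G x), ?_⟩
  refine Integrable.mono' (hG.norm.mul_const C) hm.norm.integral_prod_right'
    (ae_of_all _ fun x => ?_)
  rw [Real.norm_of_nonneg (integral_nonneg fun _ => norm_nonneg _)]
  have e : ∀ y : E, ‖G x * (rieszKer α (x - y) * f y)‖ = ‖G x‖ * (rieszKer α (x - y) * |f y|) := by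
    intro y
    rw [norm_mul, norm_mul, Real.norm_of_nonneg (rieszKer_nonneg _ _), Real.norm_eq_abs (f y)]
  simp_rw [e]
  rw [integral_const_mul]
  exact mul_le_mul_of_nonneg_left ((le_abs_self _).trans (hC x)) (norm_nonneg _)

theorem integral_mul_pot_eq {α : ℝ} (hα : 0 < α) (hn : α < dim E) {G f : E → ℝ}
    (hG : Integrable G) (hf : BddCompact f) :
    ∫ x, G x * pot α f x = ∫ y, f y * ∫ x, rieszKer α x * G (y - x) := by
  have h := integral_integral_swap (f := fun x y => G x * (rieszKer α (x - y) * f y))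
    (integrable_mul_pot_prod hα hn hG hf)
  unfold pot
  simp_rw [← integral_const_mul]
  rw [h]
  refine integral_congr_ae (ae_of_all _ fun y => ?_)
  simp only
  rw [← integral_sub_left_eq_self _ volume y]
  refine integral_congr_ae (ae_of_all _ fun x => ?_)
  simp only [sub_sub_cancel_left, rieszKer_neg]
  ring

theorem integral_mul_pot_comm {α : ℝ} (hα : 0 < α) (hn : α < dim E) {f g : E → ℝ}
    (hf : BddCompact f) (hg : BddCompact g) :
    ∫ x, f x * pot α g x = ∫ x, g x * pot α f x := by
  rw [integral_mul_pot_eq hα hn hf.integrable hg]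
  refine integral_congr_ae (ae_of_all _ fun y => ?_)
  simp only [pot]
  congr 1
  rw [← integral_sub_left_eq_self _ volume y]
  simp

theorem integral_mul_heatOp_nonneg {t : ℝ} (ht : 0 < t) {f : E → ℝ} (hf : BddCompact f) :
    0 ≤ ∫ x, f x * heatOp t f x := by
  obtain ⟨A, hA0, hA, hA1⟩ := hf.exists_bound
  have ht2 : 0 < t / 2 := by positivity
  have hfi := hf.integrable
  have h1 : ∀ x, heatOp t f x = ∫ z, heatKernel (t / 2) (x - z) * heatOp (t / 2) f z := by
    intro x
    rw [← heatOp_eq_integral_sub, heatOp_heatOp ht2 ht2 hfi, add_halves]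
  have hI : Integrable (fun p : E × E => heatOp (t / 2) f p.1 *
      (f p.2 * heatKernel (t / 2) (p.1 - p.2))) (volume.prod volume) := by
    refine Integrable.bdd_mul (c := A) ?_ (((continuous_heatOp ht2 hfi).comp
      continuous_fst).aestronglyMeasurable) (ae_of_all _ fun p => ?_)
    · exact hfi.convolution_integrand (ContinuousLinearMap.mul ℝ ℝ)
        (integrable_heatKernel ht2)
    · exact (abs_heatOp_le ht2 hfi hA hA1 _).trans (mul_le_of_le_one_right hA0 (min_le_left _ _))
  have h2 : ∫ x, f x * heatOp t f x = ∫ z, heatOp (t / 2) f z * heatOp (t / 2) f z := by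
    have h3 := integral_integral_swap (f := fun z x => heatOp (t / 2) f z *
      (f x * heatKernel (t / 2) (z - x))) hI
    simp_rw [h1 , ← integral_const_mul]
    calc _ = ∫ x, ∫ z, heatOp (t / 2) f z * (f x * heatKernel (t / 2) (z - x)) := by
            refine integral_congr_ae (ae_of_all _ fun x => integral_congr_ae
              (ae_of_all _ fun z => ?_))
            simp only
            rw [← heatKernel_neg, neg_sub]; ring
      _ = _ := by
            rw [← h3]
            refine integral_congr_ae (ae_of_all _ fun z => ?_)
            simp only
            rw [integral_const_mul]
            congr 1
            rw [heatOp_eq_integral_sub]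
            simp_rw [mul_comm]
  rw [h2]
  exact integral_nonneg fun z => mul_self_nonneg _

theorem integral_mul_pot_nonneg {α : ℝ} (hα : 0 < α) (hn : α < dim E) {f : E → ℝ}
    (hf : BddCompact f) : 0 ≤ ∫ x, f x * pot α f x := by
  obtain ⟨A, hA0, hA, hA1⟩ := hf.exists_bound
  have c1 : 0 < heatConst E (α / 2) := heatConst_pos (by linarith)
  have hm : Measurable (fun p : E × ℝ => f p.1 * (p.2 ^ (α / 2 - 1) * heatOp p.2 f p.1)) := by
    have m1 : Measurable fun p : (E × ℝ) × E => p.1.1 := measurable_fst.comp measurable_fst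
    have m2 : Measurable fun p : (E × ℝ) × E => p.1.2 := measurable_snd.comp measurable_fst
    have : StronglyMeasurable (fun p : (E × ℝ) × E => heatKernel p.1.2 p.2 * f (p.1.1 - p.2)) :=
      (((measurable_heatKernel (E := E)).comp (g := fun q : ℝ × E => heatKernel q.1 q.2)
        (f := fun p : (E × ℝ) × E => (p.1.2, p.2)) (m2.prodMk measurable_snd)).mul
        (hf.measurable.comp (m1.sub measurable_snd))).stronglyMeasurable
    have h2 : Measurable fun p : E × ℝ => heatOp p.2 f p.1 :=
      (this.integral_prod_right (ν := volume)).measurable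
    exact (hf.measurable.comp measurable_fst).mul ((measurable_snd.pow_const _).mul h2)
  have hI : Integrable (fun p : E × ℝ => f p.1 * (p.2 ^ (α / 2 - 1) * heatOp p.2 f p.1))
      (volume.prod (volume.restrict (Set.Ioi 0))) := by
    refine Integrable.mono' (hf.integrable.norm.mul_prod ((integrableOn_min_rpow
      (p := α / 2 - 1) (q := α / 2 - 1 + -(dim E) / 2) (by linarith)
      (by linarith)).const_mul A)) hm.aestronglyMeasurable ?_
    have : ∀ᵐ p : E × ℝ ∂(volume.prod (volume.restrict (Set.Ioi 0))), 0 < p.2 :=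
      Measure.quasiMeasurePreserving_snd.ae (ae_restrict_mem measurableSet_Ioi)
    filter_upwards [this] with p hp
    rw [norm_mul]
    exact mul_le_mul_of_nonneg_left (abs_rpow_mul_heatOp_le hf hA hA1 hp p.1) (norm_nonneg _)
  have h1 : heatConst E (α / 2) * ∫ x, f x * pot α f x =
      ∫ t in Set.Ioi (0 : ℝ), t ^ (α / 2 - 1) * ∫ x, f x * heatOp t f x := by
    have h2 := integral_integral_swap (f := fun x t => f x * (t ^ (α / 2 - 1) * heatOp t f x)) hI
    rw [← integral_const_mul]
    calc _ = ∫ x, ∫ t in Set.Ioi (0 : ℝ), f x * (t ^ (α / 2 - 1) * heatOp t f x) := by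
            refine integral_congr_ae (ae_of_all _ fun x => ?_)
            simp only
            rw [integral_const_mul, ← pot_eq_integral_heatOp hα hn hf]; ring
      _ = _ := by
            rw [h2]
            refine integral_congr_ae (ae_of_all _ fun t => ?_)
            simp only
            rw [← integral_const_mul]
            congr 1; ext x; ring
  have h3 : 0 ≤ heatConst E (α / 2) * ∫ x, f x * pot α f x := by
    rw [h1]
    exact setIntegral_nonneg measurableSet_Ioi fun t ht =>
      mul_nonneg (rpow_nonneg (le_of_lt ht) _) (integral_mul_heatOp_nonneg ht hf)
  exact nonneg_of_mul_nonneg_right h3 c1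

end Potential

section MaximumPrinciple

variable {E : Type*} [NormedAddCommGroup E] [InnerProductSpace ℝ E] [FiniteDimensional ℝ E]
  [MeasurableSpace E] [BorelSpace E]

theorem integrable_min_div {α : ℝ} (hα : 0 < α) (hα2 : α < 2) (hn : 0 < dim E) :
    Integrable (fun z : E => min 1 (‖z‖ ^ 2) / ‖z‖ ^ (dim E + α)) := by
  have c2 : 0 < heatConst E (-(α / 2)) := heatConst_pos (by linarith)
  have hm : Measurable (fun p : ℝ × E =>
      p.1 ^ (-(α / 2) - 1) * (heatKernel p.1 p.2 * min 1 (‖p.2‖ ^ 2))) :=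
    (measurable_fst.pow_const _).mul ((measurable_heatKernel (E := E)).mul
      ((by fun_prop : Measurable fun z : E => min 1 (‖z‖ ^ 2)).comp measurable_snd))
  have hI : Integrable (fun p : ℝ × E =>
      p.1 ^ (-(α / 2) - 1) * (heatKernel p.1 p.2 * min 1 (‖p.2‖ ^ 2)))
      ((volume.restrict (Set.Ioi 0)).prod volume) := by
    rw [integrable_prod_iff hm.aestronglyMeasurable]
    refine ⟨?_, ?_⟩
    · filter_upwards [ae_restrict_mem measurableSet_Ioi] with t ht
      exact (integrable_heatKernel_mul_min ht).const_mul _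
    · refine Integrable.mono' ((integrableOn_min_rpow (p := -(α / 2) - 1 + 1)
        (q := -(α / 2) - 1) (by linarith) (by linarith)).const_mul (8 * 2 ^ (dim E / 2)))
        hm.aestronglyMeasurable.norm.integral_prod_right' ?_
      filter_upwards [ae_restrict_mem measurableSet_Ioi] with t ht
      have ht : 0 < t := ht
      rw [Real.norm_of_nonneg (integral_nonneg fun _ => norm_nonneg _)]
      have e : ∀ y : E, ‖t ^ (-(α / 2) - 1) * (heatKernel t y * min 1 (‖y‖ ^ 2))‖ =
          t ^ (-(α / 2) - 1) * (heatKernel t y * min 1 (‖y‖ ^ 2)) := fun y =>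
        Real.norm_of_nonneg (mul_nonneg (by positivity)
          (mul_nonneg (heatKernel_nonneg ht _) (by positivity)))
      simp_rw [e]
      rw [integral_const_mul, ← rpow_mul_min_one ht]
      exact (mul_le_mul_of_nonneg_left (integral_heatKernel_mul_min_le (E := E) ht)
        (by positivity)).trans_eq (by ring)
  refine (hI.integral_prod_right.const_mul (heatConst E (-(α / 2)))⁻¹).congr ?_
  filter_upwards [ae_ne_zero hn] with z hz
  simp_rw [← mul_assoc]
  rw [integral_mul_const, integral_rpow_mul_heatKernel_levy hα hz]
  field_simp

theorem integrable_secondDiff_div {α : ℝ} (hα : 0 < α) (hα2 : α < 2) (hn : 0 < dim E)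
    {θ : E → ℝ} (hθ : ContDiff ℝ (⊤ : ℕ∞) θ) (hc : HasCompactSupport θ) :
    Integrable (fun q : E × E => secondDiff θ q.1 q.2 / ‖q.2‖ ^ (dim E + α))
      (volume.prod volume) := by
  obtain ⟨C, hC0, hC, hC1⟩ := exists_secondDiff_bound hθ hc
  have hi : Integrable θ := hθ.continuous.integrable_of_hasCompactSupport hc
  have hm : Measurable (fun q : E × E => secondDiff θ q.1 q.2 / ‖q.2‖ ^ (dim E + α)) :=
    (continuous_secondDiff hθ.continuous).measurable.div
      ((by fun_prop : Measurable fun z : E => ‖z‖ ^ (dim E + α)).comp measurable_snd)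
  rw [integrable_prod_iff' hm.aestronglyMeasurable]
  refine ⟨ae_of_all _ fun z => (integrable_secondDiff hi z).div_const (‖z‖ ^ (dim E + α)), ?_⟩
  refine Integrable.mono' ((integrable_min_div hα hα2 hn).const_mul C)
    hm.aestronglyMeasurable.norm.prod_swap.integral_prod_right' (ae_of_all _ fun z => ?_)
  rw [Real.norm_of_nonneg (integral_nonneg fun _ => norm_nonneg _)]
  have e : ∀ x : E, ‖secondDiff θ x z / ‖z‖ ^ (dim E + α)‖ =
      |secondDiff θ x z| / ‖z‖ ^ (dim E + α) := fun x => by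
    rw [norm_div, Real.norm_eq_abs, Real.norm_of_nonneg (by positivity)]
  simp_rw [e]
  rw [integral_div, ← mul_div_assoc]
  exact div_le_div_of_nonneg_right (hC1 z) (by positivity)

theorem integrable_levyOp {α : ℝ} (hα : 0 < α) (hα2 : α < 2) (hn : 0 < dim E)
    {θ : E → ℝ} (hθ : ContDiff ℝ (⊤ : ℕ∞) θ) (hc : HasCompactSupport θ) :
    Integrable (levyOp α θ) :=
  (integrable_secondDiff_div hα hα2 hn hθ hc).integral_prod_left

theorem integral_mul_levyOp {α : ℝ} (hα : 0 < α) (hα2 : α < 2) (hn : 0 < dim E)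
    {θ w : E → ℝ} (hθ : ContDiff ℝ (⊤ : ℕ∞) θ) (hc : HasCompactSupport θ)
    (hw : Continuous w) {M : ℝ} (hM : ∀ x, |w x| ≤ M) :
    Integrable (fun z : E => (∫ x, w x * secondDiff θ x z) / ‖z‖ ^ (dim E + α)) ∧
    ∫ x, w x * levyOp α θ x =
      ∫ z : E, (∫ x, w x * secondDiff θ x z) / ‖z‖ ^ (dim E + α) := by
  have hI : Integrable (fun q : E × E => w q.1 * (secondDiff θ q.1 q.2 / ‖q.2‖ ^ (dim E + α)))
      (volume.prod volume) :=
    (integrable_secondDiff_div hα hα2 hn hθ hc).bdd_mul (c := M)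
      (hw.comp continuous_fst).aestronglyMeasurable (ae_of_all _ fun q => hM _)
  have h := integral_integral_swap (f := fun x z =>
    w x * (secondDiff θ x z / ‖z‖ ^ (dim E + α))) hI
  have e : ∀ z : E, ∫ x, w x * (secondDiff θ x z / ‖z‖ ^ (dim E + α)) =
      (∫ x, w x * secondDiff θ x z) / ‖z‖ ^ (dim E + α) := fun z => by
    simp_rw [← mul_div_assoc]
    rw [integral_div]
  refine ⟨hI.integral_prod_right.congr (ae_of_all _ e), ?_⟩
  simp_rw [← e]
  rw [← h]
  simp_rw [integral_const_mul]
  rfl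

theorem weak_pot {α κ : ℝ} (hα : 0 < α) (hα2 : α < 2) (hn : α < dim E)
    (hκ : ∀ θ : E → ℝ, ContDiff ℝ (⊤ : ℕ∞) θ → HasCompactSupport θ →
      ∀ x, ∫ y, rieszKer α y * levyOp α θ (x - y) = -κ * θ x)
    {f : E → ℝ} (hf : BddCompact f) {θ : E → ℝ} (hθ : ContDiff ℝ (⊤ : ℕ∞) θ)
    (hc : HasCompactSupport θ) :
    ∫ x, pot α f x * levyOp α θ x = -κ * ∫ x, f x * θ x := by
  have h := integral_mul_pot_eq hα hn (integrable_levyOp hα hα2 (hα.trans hn) hθ hc) hf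
  simp_rw [hκ θ hθ hc] at h
  simp_rw [mul_comm (pot α f _)]
  rw [h, ← integral_const_mul]
  congr 1; ext y; ring

/-- A weak maximum principle for the fractional Laplacian. -/
theorem neg_le_of_weak {α : ℝ} (hα : 0 < α) (hα2 : α < 2) (hn : 0 < dim E) {w F : E → ℝ}
    (hw : Continuous w) (hw0 : Tendsto w (cocompact E) (𝓝 0))
    (hF : ∀ θ : E → ℝ, ContDiff ℝ (⊤ : ℕ∞) θ → HasCompactSupport θ →
      ∫ x, w x * levyOp α θ x = -∫ x, F x * θ x)
    {δ : ℝ} (hδ : 0 ≤ δ) (h : ∀ᵐ x, w x < -δ → 0 ≤ F x) (x : E) : -δ ≤ w x := by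
  have hnt : Nontrivial E := by
    have : 0 < Module.finrank ℝ E := by exact_mod_cast hn
    exact Module.finrank_pos_iff.1 this
  by_contra! hx
  obtain ⟨x₁, hx₁⟩ := hw.exists_forall_le' x
    ((hw0.eventually (lt_mem_nhds (by linarith : w x < 0))).mono fun y hy => hy.le)
  set m := w x₁ with hm
  have hmδ : m < -δ := (hx₁ x).trans_lt hx
  obtain ⟨ε, hε0, hε⟩ : ∃ ε, 0 < ε ∧ m + 4 * ε = -δ := ⟨(-δ - m) / 4, by linarith, by ring⟩
  obtain ⟨M, hM⟩ : ∃ M, ∀ x, |w x| ≤ M := by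
    obtain ⟨x₂, hx₂⟩ := hw.norm.exists_forall_ge' x (by
      have := hw0.norm.eventually (gt_mem_nhds
        (by rw [norm_zero]; exact norm_pos_iff.2 (by linarith) : ‖(0 : ℝ)‖ < ‖w x‖))
      exact this.mono fun y hy => hy.le)
    exact ⟨_, hx₂⟩
  obtain ⟨r, hr0, hr⟩ := Metric.uniformContinuous_iff.1
    (hw.uniformContinuous_of_tendsto_cocompact hw0) ε hε0
  let B : ContDiffBump (0 : E) := ⟨r / 2, r, by positivity, by linarith⟩
  let η : E → ℝ := B.normed volume
  have hη : ContDiff ℝ (⊤ : ℕ∞) η := B.contDiff_normed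
  have hηc : HasCompactSupport η := B.hasCompactSupport_normed
  let W : E → ℝ := convolution η w (ContinuousLinearMap.lsmul ℝ ℝ) volume
  have hWc : Continuous W := hηc.continuous_convolution_left _ hη.continuous
    hw.locallyIntegrable
  have hWw : ∀ y, |W y - w y| ≤ ε := fun y =>
    B.dist_normed_convolution_le hw.aestronglyMeasurable fun z hz => (hr hz).le
  have hWdef : ∀ a, W a = ∫ y, w y * η (a - y) := fun a => by
    change convolution η w (ContinuousLinearMap.lsmul ℝ ℝ) volume a = _
    rw [convolution_eq_swap]
    simp only [ContinuousLinearMap.lsmul_apply, smul_eq_mul, mul_comm]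
  have hWx₁ : W x₁ ≤ m + ε := by have := abs_le.1 (hWw x₁); linarith
  have hWfar : ∀ᶠ y in cocompact E, m + 2 * ε < W y := by
    filter_upwards [hw0.eventually (lt_mem_nhds (by linarith : m + 3 * ε < 0))] with y hy
    have := abs_le.1 (hWw y); linarith
  obtain ⟨x₀, hx₀⟩ := hWc.exists_forall_le' x₁ (hWfar.mono fun y hy => by linarith)
  set θ : E → ℝ := fun y => η (x₀ - y) with hθdef
  have hθ : ContDiff ℝ (⊤ : ℕ∞) θ := hη.comp (contDiff_const.sub contDiff_id)
  have hθc : HasCompactSupport θ := hηc.comp_homeomorph (Homeomorph.subLeft x₀)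
  have hθ0 : ∀ y, 0 ≤ θ y := fun y => B.nonneg_normed _
  have hFθ : 0 ≤ ∫ y, F y * θ y := by
    refine integral_nonneg_of_ae ?_
    filter_upwards [h] with y hy
    by_cases hyr : dist y x₀ < r
    · have h1 := abs_lt.1 (hr hyr)
      have h2 := abs_le.1 (hWw x₀)
      have h3 := hx₀ x₁
      exact mul_nonneg (hy (by linarith)) (hθ0 y)
    · have : θ y = 0 := by
        have : x₀ - y ∉ Function.support (B.normed volume) := by
          rw [B.support_normed_eq]
          simpa [dist_eq_norm, norm_sub_rev, B] using not_lt.1 hyr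
        simpa [Function.mem_support] using this
      simp [this]
  obtain ⟨hJ1, hJ2⟩ := integral_mul_levyOp hα hα2 hn hθ hθc hw hM
  have hwi : ∀ a, Integrable (fun y => w y * η (a - y)) := fun a => by
    refine Integrable.bdd_mul (c := M) ?_ hw.aestronglyMeasurable (ae_of_all _ hM)
    exact (hη.continuous.integrable_of_hasCompactSupport hηc).comp_sub_left a
  have hsd : ∀ z, ∫ y, w y * secondDiff θ y z = secondDiff W x₀ z := by
    intro z
    have e : ∀ y, w y * secondDiff θ y z = w y * η (x₀ - z - y) + w y * η (x₀ + z - y)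
        - 2 * (w y * η (x₀ - y)) := by
      intro y
      simp only [secondDiff, hθdef]
      rw [show x₀ - (y + z) = x₀ - z - y by abel, show x₀ - (y - z) = x₀ + z - y by abel]
      ring
    simp_rw [e]
    have h12 : Integrable (fun y => w y * η (x₀ - z - y) + w y * η (x₀ + z - y)) :=
      (hwi _).add (hwi _)
    rw [integral_sub h12 ((hwi _).const_mul 2), integral_add (hwi _) (hwi _), integral_const_mul,
      ← hWdef, ← hWdef, ← hWdef]
    unfold secondDiff; ring
  have hsd0 : ∀ z, 0 ≤ secondDiff W x₀ z := fun z => by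
    have h1 := hx₀ (x₀ + z)
    have h2 := hx₀ (x₀ - z)
    unfold secondDiff; linarith
  simp_rw [hsd] at hJ1 hJ2
  have hz : ∫ z : E, secondDiff W x₀ z / ‖z‖ ^ (dim E + α) = 0 := by
    refine le_antisymm ?_ (integral_nonneg fun z => div_nonneg (hsd0 z) (by positivity))
    rw [← hJ2, hF θ hθ hθc]
    linarith
  rw [integral_eq_zero_iff_of_nonneg (fun z => div_nonneg (hsd0 z) (by positivity)) hJ1] at hz
  have hz2 : (fun z => secondDiff W x₀ z) =ᵐ[volume] fun _ => 0 := by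
    filter_upwards [hz, ae_ne_zero hn] with z h1 h2
    have : 0 < ‖z‖ ^ (dim E + α) := rpow_pos_of_pos (norm_pos_iff.2 h2) _
    simpa [this.ne'] using h1
  have hz3 : (fun z => secondDiff W x₀ z) = fun _ => 0 :=
    (Continuous.ae_eq_iff_eq volume ((continuous_secondDiff hWc).comp
      (by fun_prop : Continuous fun z : E => (x₀, z))) continuous_const).1 hz2
  have f1 : ∀ᶠ z in cocompact E, m + 2 * ε < W (x₀ + z) :=
    (Homeomorph.addLeft x₀).isClosedEmbedding.tendsto_cocompact.eventually hWfar
  have f2 : ∀ᶠ z in cocompact E, m + 2 * ε < W (x₀ - z) :=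
    (Homeomorph.subLeft x₀).isClosedEmbedding.tendsto_cocompact.eventually hWfar
  obtain ⟨z, h1, h2⟩ := (f1.and f2).exists
  have h3 := congrFun hz3 z
  have h4 := hx₀ x₁
  simp only [secondDiff] at h3
  linarith

end MaximumPrinciple

section
variable {E : Type*} [NormedAddCommGroup E] [InnerProductSpace ℝ E] [FiniteDimensional ℝ E]
  [MeasurableSpace E] [BorelSpace E]

theorem BddCompact.lin {f g : E → ℝ} (hf : BddCompact f) (hg : BddCompact g) (a b : ℝ) :
    BddCompact (fun x => a * f x + b * g x) := by
  simpa using (hf.const_mul a).sub (hg.const_mul (-b))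

theorem pot_lin {α : ℝ} (hα : 0 < α) (hn : α < dim E) {f g : E → ℝ}
    (hf : BddCompact f) (hg : BddCompact g) (a b : ℝ) (x : E) :
    pot α (fun y => a * f y + b * g y) x = a * pot α f x + b * pot α g x := by
  have h := pot_sub hα hn (hf.const_mul a) (hg.const_mul (-b)) x
  rw [pot_const_mul, pot_const_mul] at h
  simpa using h

theorem BddCompact.mul_pot {α : ℝ} (hα : 0 < α) (hn : α < dim E) {f g : E → ℝ}
    (hf : BddCompact f) (hg : BddCompact g) : BddCompact (fun x => f x * pot α g x) := by
  obtain ⟨C, -, hC⟩ := exists_abs_pot_le hα hn hg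
  exact hf.mul_bdd (continuous_pot hα hn hg).measurable hC

theorem energy_lin {α : ℝ} (hα : 0 < α) (hn : α < dim E) {f g : E → ℝ}
    (hf : BddCompact f) (hg : BddCompact g) (a b : ℝ) :
    ∫ x, (a * f x + b * g x) * pot α (fun y => a * f y + b * g y) x =
      a ^ 2 * (∫ x, f x * pot α f x) + 2 * a * b * (∫ x, g x * pot α f x) +
        b ^ 2 * ∫ x, g x * pot α g x := by
  have h1 := (hf.mul_pot hα hn hf).integrable
  have h2 := (hg.mul_pot hα hn hf).integrable
  have h3 := (hg.mul_pot hα hn hg).integrable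
  have h4 := (hf.mul_pot hα hn hg).integrable
  have e : ∀ x, (a * f x + b * g x) * pot α (fun y => a * f y + b * g y) x =
      (a ^ 2 * (f x * pot α f x) + a * b * (g x * pot α f x)) +
      (a * b * (f x * pot α g x) + b ^ 2 * (g x * pot α g x)) := by
    intro x
    rw [pot_lin hα hn hf hg]; ring
  simp_rw [e]
  have k1 : Integrable (fun x => a ^ 2 * (f x * pot α f x) + a * b * (g x * pot α f x)) :=
    (h1.const_mul _).add (h2.const_mul _)
  have k2 : Integrable (fun x => a * b * (f x * pot α g x) + b ^ 2 * (g x * pot α g x)) :=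
    (h4.const_mul _).add (h3.const_mul _)
  rw [integral_add k1 k2, integral_add (h1.const_mul _) (h2.const_mul _),
    integral_add (h4.const_mul _) (h3.const_mul _)]
  simp_rw [integral_const_mul]
  rw [integral_mul_pot_comm hα hn hf hg]; ring

theorem energy_weight_le {α : ℝ} (hα : 0 < α) (hn : α < dim E) {ρ e : E → ℝ}
    (hρ : BddCompact ρ) (hρ0 : ∀ x, 0 ≤ ρ x) (he : Measurable e) {B : ℝ}
    (hB : ∀ x, |e x| ≤ B) {C : ℝ} (hC : ∀ x, pot α ρ x ≤ C) :
    ∫ x, ρ x * e x * pot α (fun y => ρ y * e y) x ≤ C * ∫ x, ρ x * e x ^ 2 := by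
  have hρe : BddCompact (fun x => ρ x * e x) := hρ.mul_bdd he hB
  have hρe2 : BddCompact (fun x => ρ x * e x ^ 2) :=
    hρ.mul_bdd (he.pow_const 2) (B := B ^ 2) fun x => by
      rw [abs_pow]; exact pow_le_pow_left₀ (abs_nonneg _) (hB x) 2
  have key : ∀ x, e x * pot α (fun y => ρ y * e y) x ≤
      (e x ^ 2 * pot α ρ x + pot α (fun y => ρ y * e y ^ 2) x) / 2 := by
    intro x
    unfold pot
    rw [← integral_const_mul, ← integral_const_mul, ← integral_add
      ((integrable_rieszKer_mul hα hn hρ x).const_mul _) (integrable_rieszKer_mul hα hn hρe2 x),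
      ← integral_div]
    refine integral_mono ((integrable_rieszKer_mul hα hn hρe x).const_mul _)
      ((((integrable_rieszKer_mul hα hn hρ x).const_mul _).add
        (integrable_rieszKer_mul hα hn hρe2 x)).div_const _) fun y => ?_
    have := mul_nonneg (mul_nonneg (rieszKer_nonneg α (x - y)) (hρ0 y)) (sq_nonneg (e x - e y))
    simp only
    nlinarith
  calc ∫ x, ρ x * e x * pot α (fun y => ρ y * e y) x
      ≤ ∫ x, (2⁻¹ * (ρ x * e x ^ 2 * pot α ρ x) +
          2⁻¹ * (ρ x * pot α (fun y => ρ y * e y ^ 2) x)) := by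
        refine integral_mono (hρe.mul_pot hα hn hρe).integrable
          (((hρe2.mul_pot hα hn hρ).integrable.const_mul _).add
            ((hρ.mul_pot hα hn hρe2).integrable.const_mul _)) fun x => ?_
        have := mul_le_mul_of_nonneg_left (key x) (hρ0 x)
        simp only
        nlinarith
    _ = ∫ x, ρ x * e x ^ 2 * pot α ρ x := by
        rw [integral_add ((hρe2.mul_pot hα hn hρ).integrable.const_mul _)
            ((hρ.mul_pot hα hn hρe2).integrable.const_mul _), integral_const_mul,
          integral_const_mul, integral_mul_pot_comm hα hn hρ hρe2]
        ring
    _ ≤ ∫ x, C * (ρ x * e x ^ 2) := by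
        refine integral_mono (hρe2.mul_pot hα hn hρ).integrable (hρe2.integrable.const_mul _)
          fun x => ?_
        have := mul_le_mul_of_nonneg_left (hC x) (mul_nonneg (hρ0 x) (sq_nonneg (e x)))
        simp only
        linarith
    _ = _ := integral_const_mul _ _

theorem integral_weight_pot_sq_le {α : ℝ} (hα : 0 < α) (hn : α < dim E) {ρ p : E → ℝ}
    (hρ : BddCompact ρ) (hρ0 : ∀ x, 0 ≤ ρ x) (hp : BddCompact p) {C : ℝ} (hC0 : 0 < C)
    (hC : ∀ x, pot α ρ x ≤ C) :
    ∫ x, ρ x * pot α p x ^ 2 ≤ C * ∫ x, p x * pot α p x := by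
  obtain ⟨B, -, hB⟩ := exists_abs_pot_le hα hn hp
  have hm := (continuous_pot hα hn hp).measurable
  have h1 := energy_weight_le hα hn hρ hρ0 hm hB hC
  have hq : BddCompact (fun x => ρ x * pot α p x) := hρ.mul_bdd hm hB
  have h2 := integral_mul_pot_nonneg hα hn (hp.lin hq C (-1))
  rw [energy_lin hα hn hp hq] at h2
  have e : ∀ x, ρ x * pot α p x * pot α p x = ρ x * pot α p x ^ 2 := fun x => by ring
  simp_rw [e] at h2
  have h3 : 0 ≤ C * (C * (∫ x, p x * pot α p x) - ∫ x, ρ x * pot α p x ^ 2) := by nlinarith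
  have := nonneg_of_mul_nonneg_right h3 hC0
  linarith

theorem energy_step {α : ℝ} (hα : 0 < α) (hn : α < dim E) {ρ p : E → ℝ}
    (hρ : BddCompact ρ) (hρ0 : ∀ x, 0 ≤ ρ x) (hp : BddCompact p) {C : ℝ}
    (hC : ∀ x, pot α ρ x ≤ C) {e : E → ℝ} (he : Measurable e) {B : ℝ} (hB : ∀ x, |e x| ≤ B)
    {Λ τ : ℝ} (hΛ : 0 < Λ) (hτ : 0 ≤ τ) (hτ1 : τ ≤ 1) (hτC : τ * C * Λ ≤ 2 * (1 - τ))
    (hep : ∀ x, Λ * (e x * pot α p x) ≤ -e x ^ 2) :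
    ∫ x, ((1 - τ) * p x + τ * (ρ x * e x)) *
        pot α (fun y => (1 - τ) * p y + τ * (ρ y * e y)) x ≤
      (1 - τ) ^ 2 * ∫ x, p x * pot α p x := by
  have hρe : BddCompact (fun x => ρ x * e x) := hρ.mul_bdd he hB
  have hρe2 : BddCompact (fun x => ρ x * e x ^ 2) :=
    hρ.mul_bdd (he.pow_const 2) (B := B ^ 2) fun x => by
      rw [abs_pow]; exact pow_le_pow_left₀ (abs_nonneg _) (hB x) 2
  rw [energy_lin hα hn hp hρe]
  have h1 := energy_weight_le hα hn hρ hρ0 he hB hC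
  have h2 : Λ * ∫ x, ρ x * e x * pot α p x ≤ -∫ x, ρ x * e x ^ 2 := by
    rw [← integral_const_mul, ← integral_neg]
    refine integral_mono ((hρe.mul_pot hα hn hp).integrable.const_mul _) hρe2.integrable.neg
      fun x => ?_
    have := mul_le_mul_of_nonneg_left (hep x) (hρ0 x)
    simp only
    linarith
  have h3 : 0 ≤ ∫ x, ρ x * e x ^ 2 :=
    integral_nonneg fun x => mul_nonneg (hρ0 x) (sq_nonneg _)
  set Q := ∫ x, ρ x * e x ^ 2
  set X := ∫ x, ρ x * e x * pot α p x
  set Y := ∫ x, ρ x * e x * pot α (fun y => ρ y * e y) x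
  suffices 2 * (1 - τ) * τ * X + τ ^ 2 * Y ≤ 0 by linarith
  have h4 : Λ * (2 * (1 - τ) * τ * X + τ ^ 2 * Y) ≤ 0 := by
    have a1 := mul_le_mul_of_nonneg_left h2 (show 0 ≤ 2 * (1 - τ) * τ by
      apply mul_nonneg _ hτ; linarith)
    have a2 := mul_le_mul_of_nonneg_left h1 (show 0 ≤ τ ^ 2 * Λ by positivity)
    have a3 := mul_le_mul_of_nonneg_right hτC (mul_nonneg hτ h3)
    nlinarith
  by_contra hcon
  have := mul_pos hΛ (not_le.1 hcon)
  linarith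
end

section
variable {E : Type*} [NormedAddCommGroup E] [InnerProductSpace ℝ E] [FiniteDimensional ℝ E]
  [MeasurableSpace E] [BorelSpace E]

theorem ae_exists_tendsto_of_geometric {X : Type*} [MeasurableSpace X] {μ : Measure X}
    {p : ℕ → X → ℝ} (hp : ∀ k, Integrable (p k) μ) {K r : ℝ} (hr0 : 0 ≤ r)
    (hr1 : r < 1) (h : ∀ k, ∫ x, |p (k + 1) x - p k x| ∂μ ≤ K * r ^ k) :
    ∀ᵐ x ∂μ, ∃ l, Tendsto (fun k => p k x) atTop (𝓝 l) := by
  have hd : ∀ k, Integrable (fun x => p (k + 1) x - p k x) μ := fun k => (hp _).sub (hp _)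
  have hs : Summable (fun k : ℕ => K * r ^ k) :=
    (summable_geometric_of_lt_one hr0 hr1).mul_left K
  have h1 := summable_norm_of_tsum_eLpNorm_ne_top (μ := μ) (p := 1) le_rfl
    (f := fun k x => p (k + 1) x - p k x) (fun k => (hd k).1) (by
      refine ne_top_of_le_ne_top hs.tsum_ofReal_ne_top (ENNReal.tsum_le_tsum fun k => ?_)
      rw [eLpNorm_one_eq_lintegral_enorm, ← ofReal_integral_norm_eq_lintegral_enorm (hd k)]
      exact ENNReal.ofReal_le_ofReal (h k))
  filter_upwards [h1] with x hx
  have h2 := (Summable.of_norm hx).hasSum.tendsto_sum_nat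
  simp_rw [Finset.sum_range_sub (fun k => p k x)] at h2
  exact ⟨_, by simpa using h2.add_const (p 0 x)⟩

theorem exists_pot_eq {α : ℝ} (hα : 0 < α) (hn : α < dim E) {ρ : E → ℝ}
    (hρ : BddCompact ρ) (hρ0 : ∀ x, 0 ≤ ρ x) {ψ : ℝ → ℝ} {P Λ : ℝ} (hψ0 : ∀ t, 0 ≤ ψ t)
    (hψP : ∀ t, ψ t ≤ P) (hψa : Antitone ψ) (hΛ : 0 < Λ)
    (hψL : ∀ s t, |ψ s - ψ t| ≤ Λ * |s - t|) :
    ∃ u : E → ℝ, Continuous u ∧ BddCompact (fun y => ρ y * ψ (u y)) ∧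
      ∀ x, u x = pot α (fun y => ρ y * ψ (u y)) x := by
  have hψm : Measurable ψ := hψa.measurable
  have hψc : Continuous ψ := by
    refine (LipschitzWith.of_dist_le_mul (K := Λ.toNNReal) fun s t => ?_).continuous
    rw [Real.dist_eq, Real.dist_eq, Real.coe_toNNReal _ hΛ.le]; exact hψL s t
  have hψb : ∀ t, |ψ t| ≤ P := fun t => by rw [abs_of_nonneg (hψ0 t)]; exact hψP t
  obtain ⟨C', hC'0, hC'⟩ := exists_abs_pot_le hα hn hρ
  obtain ⟨C, hC0, hC⟩ : ∃ C, 0 < C ∧ ∀ x, pot α ρ x ≤ C :=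
    ⟨C' + 1, by linarith, fun x => ((le_abs_self _).trans (hC' x)).trans (by linarith)⟩
  obtain ⟨τ, hτ0, hτ1, hτC⟩ : ∃ τ : ℝ, 0 < τ ∧ τ < 1 ∧ τ * C * Λ ≤ 2 * (1 - τ) := by
    have h := mul_pos hC0 hΛ
    refine ⟨1 / (1 + C * Λ), by positivity, (div_lt_one (by positivity)).2 (by linarith), ?_⟩
    have : 1 - 1 / (1 + C * Λ) = 1 / (1 + C * Λ) * (C * Λ) := by field_simp; ring
    rw [this, mul_assoc]
    have : 0 ≤ 1 / (1 + C * Λ) * (C * Λ) := by positivity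
    linarith
  obtain ⟨p, hp_zero, hp_step⟩ : ∃ p : ℕ → E → ℝ, (p 0 = fun _ => 0) ∧
      ∀ k, p (k + 1) = fun x => (1 - τ) * p k x + τ * (ρ x * ψ (pot α (p k) x)) :=
    ⟨fun k => Nat.rec (fun _ => 0)
      (fun _ f x => (1 - τ) * f x + τ * (ρ x * ψ (pot α f x))) k, rfl, fun _ => rfl⟩
  have hp_succ : ∀ k x, p (k + 1) x = (1 - τ) * p k x + τ * (ρ x * ψ (pot α (p k) x)) :=
    fun k x => congrFun (hp_step k) x
  have hpB : ∀ k, BddCompact (p k) := by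
    intro k
    induction k with
    | zero => rw [hp_zero]; exact ⟨measurable_const, ⟨0, by simp⟩, ⟨0, by simp⟩⟩
    | succ k ih =>
      rw [hp_step]
      exact ih.lin (hρ.mul_bdd (hψm.comp (continuous_pot hα hn ih).measurable)
        fun x => hψb _) (1 - τ) τ
  have hpP : ∀ k x, 0 ≤ p k x ∧ p k x ≤ ρ x * P := by
    have hP : 0 ≤ P := (hψ0 0).trans (hψP 0)
    intro k x
    induction k with
    | zero => rw [hp_zero]; exact ⟨le_rfl, mul_nonneg (hρ0 x) hP⟩
    | succ k ih =>
      rw [hp_succ]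
      have h1 := mul_le_mul_of_nonneg_left (hψP (pot α (p k) x)) (hρ0 x)
      have h2 := mul_nonneg (hρ0 x) (hψ0 (pot α (p k) x))
      have h3 : 0 ≤ 1 - τ := by linarith
      refine ⟨add_nonneg (mul_nonneg h3 ih.1) (mul_nonneg hτ0.le h2), ?_⟩
      have a1 := mul_le_mul_of_nonneg_left ih.2 h3
      have a2 := mul_le_mul_of_nonneg_left h1 hτ0.le
      linarith
  set d : ℕ → E → ℝ := fun k x => p (k + 1) x - p k x with hd
  set e : ℕ → E → ℝ := fun k x => ψ (pot α (p (k + 1)) x) - ψ (pot α (p k) x) with he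
  have hdB : ∀ k, BddCompact (d k) := fun k => (hpB (k + 1)).sub (hpB k)
  have hem : ∀ k, Measurable (e k) := fun k =>
    (hψm.comp (continuous_pot hα hn (hpB (k + 1))).measurable).sub
      (hψm.comp (continuous_pot hα hn (hpB k)).measurable)
  have heB : ∀ k x, |e k x| ≤ P + P := fun k x =>
    (abs_sub _ _).trans (add_le_add (hψb _) (hψb _))
  have hdpot : ∀ k x, pot α (d k) x = pot α (p (k + 1)) x - pot α (p k) x :=
    fun k x => pot_sub hα hn (hpB (k + 1)) (hpB k) x
  have hd_succ : ∀ k, d (k + 1) = fun x => (1 - τ) * d k x + τ * (ρ x * e k x) := by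
    intro k; funext x
    simp only [hd, he]
    rw [hp_succ (k + 1), hp_succ k]; ring
  have heL : ∀ k x, |e k x| ≤ Λ * |pot α (d k) x| := fun k x => by
    rw [hdpot]; exact hψL _ _
  have hep : ∀ k x, Λ * (e k x * pot α (d k) x) ≤ -e k x ^ 2 := by
    intro k x
    have h1 : e k x * pot α (d k) x ≤ 0 := by
      rw [hdpot]
      rcases le_total (pot α (p (k + 1)) x) (pot α (p k) x) with h | h
      · exact mul_nonpos_of_nonneg_of_nonpos (sub_nonneg.2 (hψa h)) (sub_nonpos.2 h)
      · exact mul_nonpos_of_nonpos_of_nonneg (sub_nonpos.2 (hψa h)) (sub_nonneg.2 h)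
    have h2 := mul_le_mul_of_nonneg_left (heL k x) (abs_nonneg (e k x))
    rw [← sq, sq_abs] at h2
    have h3 : |e k x| * |pot α (d k) x| = -(e k x * pot α (d k) x) := by
      rw [← abs_mul, abs_of_nonpos h1]
    nlinarith
  set En : ℕ → ℝ := fun k => ∫ x, d k x * pot α (d k) x with hEn
  have hE0 : 0 ≤ En 0 := integral_mul_pot_nonneg hα hn (hdB 0)
  have hEs : ∀ k, En k ≤ ((1 - τ) ^ k) ^ 2 * En 0 := by
    intro k
    induction k with
    | zero => simp
    | succ k ih =>
      have h1 := energy_step hα hn hρ hρ0 (hdB k) hC (hem k) (heB k) hΛ hτ0.le hτ1.le hτC (hep k)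
      have h2 := mul_le_mul_of_nonneg_left ih (sq_nonneg (1 - τ))
      have h3 : En (k + 1) ≤ (1 - τ) ^ 2 * En k := by
        simp only [hEn]; rw [hd_succ]; exact h1
      refine h3.trans (h2.trans (le_of_eq ?_))
      ring
  set S : ℝ := ((∫ x, ρ x) + C * En 0) / 2 with hS
  have hS0 : 0 ≤ S := by
    have : 0 ≤ ∫ x, ρ x := integral_nonneg hρ0
    positivity
  have hρg : ∀ k, BddCompact (fun x => ρ x * |pot α (d k) x|) := fun k => by
    obtain ⟨B, -, hB⟩ := exists_abs_pot_le hα hn (hdB k)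
    exact hρ.mul_bdd (continuous_pot hα hn (hdB k)).measurable.abs (B := B) (by simpa using hB)
  have hG : ∀ k, ∫ x, ρ x * |pot α (d k) x| ≤ S * (1 - τ) ^ k := by
    intro k
    have hr : 0 < (1 - τ) ^ k := pow_pos (by linarith) k
    set r := (1 - τ) ^ k with hrdef
    have hg2 : BddCompact (fun x => ρ x * pot α (d k) x ^ 2) := by
      obtain ⟨B, -, hB⟩ := exists_abs_pot_le hα hn (hdB k)
      refine hρ.mul_bdd ((continuous_pot hα hn (hdB k)).measurable.pow_const 2) (B := B ^ 2)
        fun x => ?_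
      rw [abs_pow]; exact pow_le_pow_left₀ (abs_nonneg _) (hB x) 2
    calc ∫ x, ρ x * |pot α (d k) x|
        ≤ ∫ x, (r / 2 * ρ x + 1 / (2 * r) * (ρ x * pot α (d k) x ^ 2)) := by
          refine integral_mono (hρg k).integrable
            ((hρ.integrable.const_mul _).add (hg2.integrable.const_mul _)) fun x => ?_
          have h1 : |pot α (d k) x| ≤ r / 2 + 1 / (2 * r) * pot α (d k) x ^ 2 := by
            have : r / 2 + 1 / (2 * r) * pot α (d k) x ^ 2 - |pot α (d k) x| =
                (r - |pot α (d k) x|) ^ 2 / (2 * r) := by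
              field_simp; rw [← sq_abs (pot α (d k) x)]; ring
            have h2 : 0 ≤ (r - |pot α (d k) x|) ^ 2 / (2 * r) := by positivity
            linarith
          have := mul_le_mul_of_nonneg_left h1 (hρ0 x)
          simp only
          linarith
      _ = r / 2 * (∫ x, ρ x) + 1 / (2 * r) * ∫ x, ρ x * pot α (d k) x ^ 2 := by
          rw [integral_add (hρ.integrable.const_mul _) (hg2.integrable.const_mul _),
            integral_const_mul, integral_const_mul]
      _ ≤ r / 2 * (∫ x, ρ x) + 1 / (2 * r) * (C * (r ^ 2 * En 0)) := by
          gcongr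
          exact (integral_weight_pot_sq_le hα hn hρ hρ0 (hdB k) hC0 hC).trans
            (mul_le_mul_of_nonneg_left (hEs k) hC0.le)
      _ = S * r := by rw [hS]; field_simp
  set K : ℝ := (∫ x, |d 0 x|) + 2 * (Λ * S) with hK
  have hD : ∀ k, ∫ x, |d k x| ≤ K * (1 - τ / 2) ^ k := by
    intro k
    induction k with
    | zero => simp only [pow_zero, mul_one, hK]; linarith [mul_nonneg hΛ.le hS0]
    | succ k ih =>
      have h1 : ∫ x, |d (k + 1) x| ≤
          (1 - τ) * (∫ x, |d k x|) + τ * Λ * ∫ x, ρ x * |pot α (d k) x| := by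
        rw [← integral_const_mul, ← integral_const_mul,
          ← integral_add ((hdB k).abs.integrable.const_mul _) ((hρg k).integrable.const_mul _)]
        refine integral_mono (hdB _).abs.integrable
          (((hdB k).abs.integrable.const_mul _).add ((hρg k).integrable.const_mul _)) fun x => ?_
        simp only
        rw [hd_succ]
        refine (abs_add_le _ _).trans ?_
        rw [abs_mul, abs_mul, abs_mul, abs_of_nonneg (hρ0 x), abs_of_pos hτ0,
          abs_of_pos (by linarith : 0 < 1 - τ)]
        have := mul_le_mul_of_nonneg_left (heL k x) (mul_nonneg hτ0.le (hρ0 x))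
        linarith
      have hpw : (1 - τ) ^ k ≤ (1 - τ / 2) ^ k := pow_le_pow_left₀ (by linarith) (by linarith) k
      have h2 : Λ * S ≤ K / 2 := by
        have : 0 ≤ ∫ x, |d 0 x| := integral_nonneg fun x => abs_nonneg _
        rw [hK]; linarith
      have h3 := mul_le_mul_of_nonneg_left (hG k) (mul_nonneg hτ0.le hΛ.le)
      have h4 := mul_le_mul_of_nonneg_left hpw (mul_nonneg (mul_nonneg hτ0.le hΛ.le) hS0)
      have h5 := mul_le_mul_of_nonneg_left ih (by linarith : 0 ≤ 1 - τ)
      have h6 := mul_le_mul_of_nonneg_right h2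
        (mul_nonneg hτ0.le (pow_nonneg (by linarith : 0 ≤ 1 - τ / 2) k))
      rw [pow_succ]
      nlinarith
  obtain ⟨q, hqm, hq⟩ := measurable_limit_of_tendsto_metrizable_ae
    (fun k => (hpB k).measurable.aemeasurable)
    (ae_exists_tendsto_of_geometric (fun k => (hpB k).integrable) (by linarith) (by linarith) hD)
  set u := pot α q with hu
  have hpot : ∀ x, Tendsto (fun k => pot α (p k) x) atTop (𝓝 (u x)) := by
    intro x
    refine tendsto_integral_of_dominated_convergence (fun y => rieszKer α (x - y) * (ρ y) * P)
      (fun k => (integrable_rieszKer_mul hα hn (hpB k) x).1)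
      ((integrable_rieszKer_mul hα hn hρ x).mul_const P) (fun k => ae_of_all _ fun y => ?_) ?_
    · rw [norm_mul, Real.norm_of_nonneg (rieszKer_nonneg _ _), Real.norm_of_nonneg (hpP k y).1,
        mul_assoc]
      exact mul_le_mul_of_nonneg_left (hpP k y).2 (rieszKer_nonneg _ _)
    · filter_upwards [hq] with y hy using hy.const_mul _
  have hum : Measurable u := measurable_of_tendsto_metrizable
    (fun k => (continuous_pot hα hn (hpB k)).measurable) (tendsto_pi_nhds.2 hpot)
  have hF : BddCompact (fun y => ρ y * ψ (u y)) := hρ.mul_bdd (hψm.comp hum) fun x => hψb _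
  have hqe : q =ᵐ[volume] fun y => ρ y * ψ (u y) := by
    filter_upwards [hq] with y hy
    have h1 : Tendsto (fun k => p (k + 1) y) atTop (𝓝 ((1 - τ) * q y + τ * (ρ y * ψ (u y)))) := by
      simp_rw [hp_succ]
      exact (hy.const_mul _).add
        ((((hψc.tendsto _).comp (hpot y)).const_mul _).const_mul _)
    have h2 := tendsto_nhds_unique h1 ((tendsto_add_atTop_iff_nat 1).2 hy)
    have h3 : τ * (q y - ρ y * ψ (u y)) = 0 := by linarith
    rcases mul_eq_zero.1 h3 with h | h
    · exact absurd h hτ0.ne'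
    · linarith
  have hfix : ∀ x, u x = pot α (fun y => ρ y * ψ (u y)) x := fun x =>
    integral_congr_ae (by filter_upwards [hqe] with y hy; rw [hy])
  refine ⟨u, ?_, hF, hfix⟩
  rw [show u = pot α (fun y => ρ y * ψ (u y)) from funext hfix]
  exact continuous_pot hα hn hF
end

section
variable {E : Type*} [NormedAddCommGroup E] [InnerProductSpace ℝ E] [FiniteDimensional ℝ E]
  [MeasurableSpace E] [BorelSpace E]

/-- Restriction of a function to the closed ball of radius `n`, extended by zero. -/
def ballTrunc (ρ : E → ℝ) (n : ℕ) : E → ℝ := (Metric.closedBall (0 : E) n).indicator ρ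

theorem ballTrunc_of_le {ρ : E → ℝ} {n : ℕ} {x : E} (h : ‖x‖ ≤ n) : ballTrunc ρ n x = ρ x :=
  Set.indicator_of_mem (by simpa using h) _

theorem ballTrunc_of_lt {ρ : E → ℝ} {n : ℕ} {x : E} (h : (n : ℝ) < ‖x‖) : ballTrunc ρ n x = 0 :=
  Set.indicator_of_notMem (by simpa using h) _

theorem ballTrunc_nonneg {ρ : E → ℝ} (hρ : ∀ x, 0 ≤ ρ x) (n : ℕ) (x : E) : 0 ≤ ballTrunc ρ n x :=
  Set.indicator_nonneg (fun x _ => hρ x) x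

theorem ballTrunc_le {ρ : E → ℝ} (hρ : ∀ x, 0 ≤ ρ x) (n : ℕ) (x : E) : ballTrunc ρ n x ≤ ρ x :=
  Set.indicator_le_self' (fun x _ => hρ x) x

theorem ballTrunc_mono {ρ : E → ℝ} (hρ : ∀ x, 0 ≤ ρ x) {m n : ℕ} (h : m ≤ n) (x : E) :
    ballTrunc ρ m x ≤ ballTrunc ρ n x := by
  rcases le_or_gt ‖x‖ m with hx | hx
  · rw [ballTrunc_of_le hx, ballTrunc_of_le (hx.trans (by exact_mod_cast h))]
  · rw [ballTrunc_of_lt hx]; exact ballTrunc_nonneg hρ n x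

theorem bddCompact_ballTrunc {ρ : E → ℝ} (hm : Measurable ρ) (hρ : ∀ x, 0 ≤ ρ x)
    (hb : ∀ R : ℝ, ∃ M : ℝ, ∀ x : E, ‖x‖ ≤ R → ρ x ≤ M) (n : ℕ) : BddCompact (ballTrunc ρ n) := by
  obtain ⟨M, hM⟩ := hb n
  refine ⟨hm.indicator measurableSet_closedBall, ⟨max M 0, fun x => ?_⟩,
    ⟨n, fun x hx => ballTrunc_of_lt hx⟩⟩
  rw [abs_of_nonneg (ballTrunc_nonneg hρ n x)]
  rcases le_or_gt ‖x‖ n with hx | hx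
  · rw [ballTrunc_of_le hx]; exact (hM x hx).trans (le_max_left _ _)
  · rw [ballTrunc_of_lt hx]; exact le_max_right _ _

theorem ofReal_pot_eq {α : ℝ} (hα : 0 < α) (hn : α < dim E) {f : E → ℝ} (hf : BddCompact f)
    (h0 : ∀ x, 0 ≤ f x) (x : E) :
    ENNReal.ofReal (pot α f x) = ∫⁻ y, ENNReal.ofReal (f y * rieszKer α (x - y)) := by
  unfold pot
  rw [ofReal_integral_eq_lintegral_ofReal (integrable_rieszKer_mul hα hn hf x)
    (ae_of_all _ fun y => mul_nonneg (rieszKer_nonneg _ _) (h0 y))]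
  simp_rw [mul_comm]

theorem integrable_bdd_mul_levyOp {α : ℝ} (hα : 0 < α) (hα2 : α < 2) (hn : 0 < dim E)
    {u : E → ℝ} (hu : Continuous u) {M : ℝ} (hM : ∀ x, |u x| ≤ M)
    {θ : E → ℝ} (hθ : ContDiff ℝ (⊤ : ℕ∞) θ) (hc : HasCompactSupport θ) :
    Integrable (fun x => u x * levyOp α θ x) :=
  (integrable_levyOp hα hα2 hn hθ hc).bdd_mul hu.aestronglyMeasurable (ae_of_all _ hM)

theorem pot_le_of_weak {α κ : ℝ} (hα : 0 < α) (hα2 : α < 2) (hn : α < dim E)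
    (hκ : ∀ θ : E → ℝ, ContDiff ℝ (⊤ : ℕ∞) θ → HasCompactSupport θ →
      ∀ x, ∫ y, rieszKer α y * levyOp α θ (x - y) = -κ * θ x)
    {u F : E → ℝ} (hu : Continuous u) {M : ℝ} (hM : ∀ x, |u x| ≤ M)
    (hu0 : Tendsto u (cocompact E) (𝓝 0)) (hFl : LocallyIntegrable F)
    (hF : ∀ θ : E → ℝ, ContDiff ℝ (⊤ : ℕ∞) θ → HasCompactSupport θ →
      ∫ x, u x * levyOp α θ x = -∫ x, F x * θ x)
    {f : E → ℝ} (hf : BddCompact f) (hfF : ∀ᵐ x, κ * f x ≤ F x) (x : E) :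
    pot α f x ≤ u x := by
  obtain ⟨C, -, hC⟩ := exists_abs_pot_le hα hn hf
  have hpc := continuous_pot hα hn hf
  have h := neg_le_of_weak (w := fun x => u x - pot α f x) (F := fun x => F x - κ * f x) hα hα2
    (hα.trans hn) (hu.sub hpc) (by simpa using hu0.sub (tendsto_pot hn hf)) (fun θ hθ hc => ?_)
    le_rfl (by filter_upwards [hfF] with x hx _ using sub_nonneg.2 hx) x
  · linarith
  · have i1 := integrable_bdd_mul_levyOp hα hα2 (hα.trans hn) hu hM hθ hc
    have i2 := integrable_bdd_mul_levyOp hα hα2 (hα.trans hn) hpc hC hθ hc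
    have i3 : Integrable (fun x => F x * θ x) :=
      hFl.integrable_smul_right_of_hasCompactSupport hθ.continuous hc
    have i4 : Integrable (fun x => f x * θ x) :=
      hf.integrable.locallyIntegrable.integrable_smul_right_of_hasCompactSupport hθ.continuous hc
    simp_rw [sub_mul, mul_assoc]
    rw [integral_sub i1 i2, integral_sub i3 (i4.const_mul _), hF θ hθ hc,
      weak_pot hα hα2 hn hκ hf hθ hc, integral_const_mul]
    ring

theorem lintegral_riesz_le_of_weak {α κ : ℝ} (hα : 0 < α) (hα2 : α < 2) (hn : α < dim E)
    (hκ0 : 0 < κ) (hκ : ∀ θ : E → ℝ, ContDiff ℝ (⊤ : ℕ∞) θ → HasCompactSupport θ →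
      ∀ x, ∫ y, rieszKer α y * levyOp α θ (x - y) = -κ * θ x)
    {u F : E → ℝ} (hu : Continuous u) {M : ℝ} (hM : ∀ x, |u x| ≤ M)
    (hu0 : Tendsto u (cocompact E) (𝓝 0)) (hFl : LocallyIntegrable F)
    (hF : ∀ θ : E → ℝ, ContDiff ℝ (⊤ : ℕ∞) θ → HasCompactSupport θ →
      ∫ x, u x * levyOp α θ x = -∫ x, F x * θ x)
    {ρ : E → ℝ} (hm : Measurable ρ) (hρ : ∀ x, 0 ≤ ρ x)
    (hb : ∀ R : ℝ, ∃ M : ℝ, ∀ x : E, ‖x‖ ≤ R → ρ x ≤ M) {A : ℝ} (hA : 0 < A)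
    (hρF : ∀ᵐ x, ρ x ≤ A * F x) (x : E) :
    ∫⁻ y, ENNReal.ofReal (ρ y * rieszKer α (x - y)) ≤ ENNReal.ofReal (A * κ * u x) := by
  have hB := bddCompact_ballTrunc hm hρ hb
  have h1 : ∀ n : ℕ, pot α (ballTrunc ρ n) x ≤ A * κ * u x := by
    intro n
    have := pot_le_of_weak hα hα2 hn hκ hu hM hu0 hFl hF ((hB n).const_mul (A * κ)⁻¹) (by
      filter_upwards [hρF] with y hy
      have : κ * ((A * κ)⁻¹ * ballTrunc ρ n y) = A⁻¹ * ballTrunc ρ n y := by field_simp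
      rw [this, inv_mul_le_iff₀ hA]
      exact (ballTrunc_le hρ n y).trans hy) x
    rwa [pot_const_mul, inv_mul_le_iff₀ (by positivity)] at this
  have hk := measurable_rieszKer (E := E) α
  refine le_of_tendsto' (lintegral_tendsto_of_tendsto_of_monotone
    (f := fun n y => ENNReal.ofReal (ballTrunc ρ n y * rieszKer α (x - y))) (fun n => ?_)
    (ae_of_all _ fun y m n hmn => ?_) (ae_of_all _ fun y => ?_)) fun n => ?_
  · exact (((hB n).measurable.mul (hk.comp (measurable_const.sub measurable_id))).ennreal_ofReal
      ).aemeasurable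
  · exact ENNReal.ofReal_le_ofReal
      (mul_le_mul_of_nonneg_right (ballTrunc_mono hρ hmn y) (rieszKer_nonneg _ _))
  · obtain ⟨n0, hn0⟩ := exists_nat_ge ‖y‖
    refine tendsto_const_nhds.congr' ?_
    filter_upwards [eventually_ge_atTop n0] with n hn
    rw [ballTrunc_of_le (hn0.trans (by exact_mod_cast hn))]
  · rw [← ofReal_pot_eq hα hn (hB n) (ballTrunc_nonneg hρ n)]
    exact ENNReal.ofReal_le_ofReal (h1 n)

end

section
variable {X : Type*} [MeasurableSpace X]

theorem measurable_comp_of_continuousOn_Ioi {φ : ℝ → ℝ≥0∞} (hφ : ContinuousOn φ (Set.Ioi 0))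
    {u : X → ℝ} (hu : Measurable u) (hu0 : ∀ x, 0 ≤ u x) : Measurable fun x => φ (u x) := by
  have h1 : Measurable ((Set.Ioi (0 : ℝ)).piecewise φ fun _ => φ 0) :=
    hφ.measurable_piecewise continuousOn_const measurableSet_Ioi
  have h2 : (fun x => φ (u x)) = ((Set.Ioi (0 : ℝ)).piecewise φ fun _ => φ 0) ∘ u := by
    funext x
    rcases (hu0 x).lt_or_eq with h | h
    · simp [Set.piecewise, h]
    · simp [Set.piecewise, ← h]
  rw [h2]; exact h1.comp hu

end

section
variable {N : ℕ} {α : ℝ}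

theorem dim_euclideanSpace : dim (EuclideanSpace ℝ (Fin N)) = N := by
  simp [dim]

theorem fracLapCoeff_pos (hα : 0 < α) (hα2 : α < 2) : 0 < fracLapCoeff N α := by
  have h1 : 0 < Real.Gamma (((N : ℝ) + α) / 2) := Real.Gamma_pos_of_pos (by positivity)
  have h2 : Real.Gamma (-α / 2) ≠ 0 := by
    refine Real.Gamma_ne_zero fun m hm => ?_
    have h3 : α = 2 * m := by linarith
    rcases Nat.eq_zero_or_pos m with h | h
    · subst h; simp at h3; linarith
    · have : (1 : ℝ) ≤ m := by exact_mod_cast h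
      linarith
  have h3 : 0 < |Real.Gamma (-α / 2)| := abs_pos.2 h2
  unfold fracLapCoeff
  have := Real.pi_pos
  positivity

theorem fracLap_eq (θ : EuclideanSpace ℝ (Fin N) → ℝ) (x : EuclideanSpace ℝ (Fin N)) :
    fracLap N α θ x = fracLapCoeff N α / 2 * levyOp α θ x := by
  unfold fracLap levyOp secondDiff
  rw [dim_euclideanSpace]

theorem rieszKer_eq (x : EuclideanSpace ℝ (Fin N)) :
    rieszKer α x = ‖x‖ ^ (-((N : ℝ) - α)) := by
  unfold rieszKer
  rw [dim_euclideanSpace]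

theorem tendsto_riesz_of_sol (hα : 0 < α) (hα2 : α < 2) (hN : 3 ≤ N)
    {ρ : EuclideanSpace ℝ (Fin N) → ℝ} (hρm : Measurable ρ) (hρnn : ∀ x, 0 ≤ ρ x)
    (hρlb : ∀ R : ℝ, ∃ M : ℝ, ∀ x : EuclideanSpace ℝ (Fin N), ‖x‖ ≤ R → ρ x ≤ M)
    {φ : ℝ → ℝ≥0∞} (hφc : ContinuousOn φ (Set.Ioi 0)) (hφanti : AntitoneOn φ (Set.Ioi 0))
    (hφpos : ∀ t : ℝ, 0 < t → 0 < φ t ∧ φ t < ⊤)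
    (hφ0 : Tendsto φ (nhdsWithin 0 (Set.Ioi 0)) (nhds (φ 0)))
    {u : EuclideanSpace ℝ (Fin N) → ℝ} (hu : NegEntireSol N α ρ φ u)
    (hu0 : Tendsto u (cocompact (EuclideanSpace ℝ (Fin N))) (𝓝 0)) :
    Tendsto (fun x : EuclideanSpace ℝ (Fin N) =>
        ∫⁻ y, ENNReal.ofReal (ρ y * rieszKer α (x - y)))
      (cocompact (EuclideanSpace ℝ (Fin N))) (𝓝 0) := by
  obtain ⟨huc, ⟨M, hM⟩, hunn, hloc, hweak⟩ := hu
  have hn : α < dim (EuclideanSpace ℝ (Fin N)) := by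
    rw [dim_euclideanSpace]
    have : (3 : ℝ) ≤ N := by exact_mod_cast hN
    linarith
  obtain ⟨κ, hκ0, hκ⟩ := exists_integral_rieszKer_mul_levyOp
    (E := EuclideanSpace ℝ (Fin N)) hα hα2 hn
  set c := fracLapCoeff N α / 2 with hc
  have hc0 : 0 < c := half_pos (fracLapCoeff_pos hα hα2)
  set G : EuclideanSpace ℝ (Fin N) → ℝ≥0∞ := fun x => ENNReal.ofReal (ρ x) * φ (u x) with hG
  have hGm : Measurable G := hρm.ennreal_ofReal.mul
    (measurable_comp_of_continuousOn_Ioi hφc huc.measurable hunn)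
  have hGint : LocallyIntegrable fun x => (G x).toReal := by
    rw [locallyIntegrable_iff]
    exact fun K hK => integrable_toReal_of_lintegral_ne_top hGm.aemeasurable (hloc K hK)
  have hfin : ∀ᵐ x, G x < ⊤ := by
    have h1 : ∀ᵐ x, ∀ n : ℕ, x ∈ Metric.closedBall (0 : EuclideanSpace ℝ (Fin N)) n → G x < ⊤ :=
      ae_all_iff.2 fun n => (ae_restrict_iff' measurableSet_closedBall).1
        (ae_lt_top hGm (hloc _ (isCompact_closedBall _ _)))
    filter_upwards [h1] with x hx
    obtain ⟨n, hn⟩ := exists_nat_ge ‖x‖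
    exact hx n (by simpa using hn)
  set T := max M 0 + 1 with hT
  have hT0 : 0 < T := by positivity
  have huT : ∀ x, u x ≤ T := fun x => (hM x).trans (by linarith [le_max_left M 0])
  have hφT : ∀ x, φ T ≤ φ (u x) := by
    intro x
    rcases (hunn x).lt_or_eq with h | h
    · exact hφanti h hT0 (huT x)
    · rw [← h]
      refine ge_of_tendsto hφ0 ?_
      filter_upwards [Ioo_mem_nhdsGT hT0] with t ht
      exact hφanti ht.1 hT0 ht.2.le
  have hτ : 0 < (φ T).toReal := ENNReal.toReal_pos (hφpos T hT0).1.ne' (hφpos T hT0).2.ne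
  have key := lintegral_riesz_le_of_weak hα hα2 hn hκ0 hκ huc
    (M := T) (fun x => by rw [abs_of_nonneg (hunn x)]; exact huT x) hu0
    (F := fun x => c⁻¹ * (G x).toReal) (hGint.smul c⁻¹) (fun θ hθ hcs => by
      have h1 := hweak θ hθ hcs
      simp_rw [fracLap_eq, mul_left_comm _ (fracLapCoeff N α / 2)] at h1
      rw [integral_const_mul] at h1
      simp_rw [mul_assoc]
      rw [integral_const_mul, ← mul_neg, eq_inv_mul_iff_mul_eq₀ hc0.ne']
      exact h1) hρm hρnn hρlb (A := c / (φ T).toReal) (by positivity) (by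
      filter_upwards [hfin] with x hx
      have h1 : ENNReal.ofReal (ρ x) * φ T ≤ G x := mul_le_mul_right (hφT x) _
      have h2 := ENNReal.toReal_mono hx.ne h1
      rw [ENNReal.toReal_mul, ENNReal.toReal_ofReal (hρnn x)] at h2
      have : c / (φ T).toReal * (c⁻¹ * (G x).toReal) = (G x).toReal / (φ T).toReal := by
        field_simp
      rw [this, le_div_iff₀ hτ]; exact h2)
  refine tendsto_of_tendsto_of_tendsto_of_le_of_le tendsto_const_nhds ?_ (fun x => zero_le)
    key
  have h2 : Tendsto (fun x => c / (φ T).toReal * κ * u x)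
      (cocompact (EuclideanSpace ℝ (Fin N))) (𝓝 0) := by
    simpa using hu0.const_mul (c / (φ T).toReal * κ)
  simpa using ENNReal.tendsto_ofReal h2
end

section

/-- Inf-convolution regularisation of a nonincreasing function on the half line: an
`L`-Lipschitz nonincreasing function approximating `g` from below. -/
def lipReg (g : ℝ → ℝ) (L t : ℝ) : ℝ := ⨅ r : Set.Ioi (0 : ℝ), (g (max t 0 + r) + L * r)

variable {g : ℝ → ℝ} {L : ℝ}

theorem lipReg_term_nonneg (hg0 : ∀ t, 0 < t → 0 < g t) (hL : 0 ≤ L) (t : ℝ)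
    (r : Set.Ioi (0 : ℝ)) : 0 ≤ g (max t 0 + r) + L * r := by
  have hr : 0 < (r : ℝ) := r.2
  have := hg0 (max t 0 + r) (by positivity)
  positivity

theorem lipReg_nonneg (hg0 : ∀ t, 0 < t → 0 < g t) (hL : 0 ≤ L) (t : ℝ) : 0 ≤ lipReg g L t :=
  Real.iInf_nonneg fun r => lipReg_term_nonneg hg0 hL t r

theorem lipReg_le (hg0 : ∀ t, 0 < t → 0 < g t) (hL : 0 ≤ L) (t : ℝ) {r : ℝ} (hr : 0 < r) :
    lipReg g L t ≤ g (max t 0 + r) + L * r :=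
  ciInf_le (f := fun r : Set.Ioi (0 : ℝ) => g (max t 0 + r) + L * r)
    ⟨0, by rintro _ ⟨r, rfl⟩; exact lipReg_term_nonneg hg0 hL t r⟩ ⟨r, hr⟩

theorem le_lipReg {t a : ℝ} (h : ∀ r, 0 < r → a ≤ g (max t 0 + r) + L * r) :
    a ≤ lipReg g L t := by
  have : Nonempty (Set.Ioi (0 : ℝ)) := ⟨⟨1, Set.mem_Ioi.2 one_pos⟩⟩
  exact le_ciInf fun r => h r r.2

theorem lipReg_le_const (hg0 : ∀ t, 0 < t → 0 < g t) (hga : AntitoneOn g (Set.Ioi 0))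
    (hL : 0 ≤ L) (t : ℝ) : lipReg g L t ≤ g 1 + L := by
  have h := lipReg_le hg0 hL t one_pos
  have h2 : g (max t 0 + 1) ≤ g 1 := hga (by simp : (1 : ℝ) ∈ Set.Ioi 0)
    (show (0 : ℝ) < max t 0 + 1 by positivity) (by linarith [le_max_right t 0])
  linarith

theorem lipReg_antitone (hg0 : ∀ t, 0 < t → 0 < g t) (hga : AntitoneOn g (Set.Ioi 0))
    (hL : 0 ≤ L) : Antitone (lipReg g L) := by
  intro s t hst
  refine le_lipReg fun r hr => (lipReg_le hg0 hL t hr).trans ?_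
  have h1 : max s 0 ≤ max t 0 := max_le_max_right 0 hst
  have h2 : g (max t 0 + r) ≤ g (max s 0 + r) :=
    hga (show (0 : ℝ) < max s 0 + r by positivity) (show (0 : ℝ) < max t 0 + r by positivity)
      (by linarith)
  linarith

theorem lipReg_lipschitz (hg0 : ∀ t, 0 < t → 0 < g t) (hga : AntitoneOn g (Set.Ioi 0))
    (hL : 0 ≤ L) (s t : ℝ) : |lipReg g L s - lipReg g L t| ≤ L * |s - t| := by
  wlog hst : s ≤ t generalizing s t
  · rw [abs_sub_comm, abs_sub_comm s t]; exact this t s (le_of_not_ge hst)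
  have h1 := lipReg_antitone hg0 hga hL hst
  rw [abs_of_nonneg (sub_nonneg.2 h1), abs_of_nonpos (sub_nonpos.2 hst)]
  have h2 : max s 0 ≤ max t 0 := max_le_max_right 0 hst
  have h3 : max t 0 - max s 0 ≤ t - s := by
    rcases le_total s 0 with h | h <;> rcases le_total t 0 with h' | h' <;>
      simp only [max_eq_left, max_eq_right, h, h'] <;> linarith
  have h4 : lipReg g L s - L * (max t 0 - max s 0) ≤ lipReg g L t := by
    refine le_lipReg fun r hr => ?_
    have := lipReg_le hg0 hL s (r := max t 0 - max s 0 + r) (by linarith)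
    rw [show max s 0 + (max t 0 - max s 0 + r) = max t 0 + r by ring] at this
    linarith
  have h5 := mul_le_mul_of_nonneg_left h3 hL
  linarith

theorem lipReg_le_self (hg0 : ∀ t, 0 < t → 0 < g t) (hgc : ContinuousOn g (Set.Ioi 0))
    (hL : 0 ≤ L) {t : ℝ} (ht : 0 < t) : lipReg g L t ≤ g t := by
  have h1 : Tendsto (fun r => g (max t 0 + r) + L * r) (𝓝[>] 0) (𝓝 (g (t + 0) + L * 0)) := by
    rw [max_eq_left ht.le]
    refine Tendsto.add ?_ ((continuous_const.mul continuous_id).tendsto' 0 _ rfl |>.mono_left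
      nhdsWithin_le_nhds)
    have h2 : ContinuousAt g (t + 0) := by
      rw [add_zero]; exact hgc.continuousAt (Ioi_mem_nhds ht)
    exact (h2.tendsto.comp ((continuous_const.add continuous_id).tendsto' 0 _ rfl)).mono_left
      nhdsWithin_le_nhds
  rw [add_zero, mul_zero, add_zero] at h1
  refine ge_of_tendsto h1 ?_
  filter_upwards [self_mem_nhdsWithin] with r hr using lipReg_le hg0 hL t hr

theorem le_lipReg_of_le (hg0 : ∀ t, 0 < t → 0 < g t) (hga : AntitoneOn g (Set.Ioi 0))
    {η t : ℝ} (hη : 0 < η) (ht : 0 ≤ t) (h : g η ≤ L * η) : g (t + η) ≤ lipReg g L t := by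
  have hL : 0 ≤ L := by
    have := (hg0 η hη).le.trans h
    exact nonneg_of_mul_nonneg_left this hη
  refine le_lipReg fun r hr => ?_
  rw [max_eq_left ht]
  have htη : 0 < t + η := by linarith
  rcases le_total r η with hrη | hrη
  · have := hga (show (0 : ℝ) < t + r by linarith) htη (by linarith)
    have := mul_nonneg hL hr.le
    linarith
  · have h1 := hga hη htη (by linarith)
    have h2 := mul_le_mul_of_nonneg_left hrη hL
    have := hg0 (t + r) (by linarith)
    linarith

end

section
variable {E : Type*} [NormedAddCommGroup E] [InnerProductSpace ℝ E] [FiniteDimensional ℝ E]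
  [MeasurableSpace E] [BorelSpace E]

theorem pot_le_add_of {α : ℝ} (hα : 0 < α) (hα2 : α < 2) (hn : α < dim E) {f g : E → ℝ}
    (hf : BddCompact f) (hg : BddCompact g) {δ : ℝ} (hδ : 0 ≤ δ)
    (h : ∀ x, pot α g x + δ < pot α f x → f x ≤ g x) (x : E) : pot α f x ≤ pot α g x + δ := by
  obtain ⟨κ, hκ0, hκ⟩ := exists_integral_rieszKer_mul_levyOp (E := E) hα hα2 hn
  have hgf := hg.sub hf
  have e := pot_sub hα hn hg hf
  have h1 := neg_le_of_weak (w := pot α fun y => g y - f y) (F := fun y => κ * (g y - f y))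
    hα hα2 (hα.trans hn) (continuous_pot hα hn hgf) (tendsto_pot hn hgf) (fun θ hθ hc => by
      rw [weak_pot hα hα2 hn hκ hgf hθ hc]
      simp_rw [mul_assoc]
      rw [integral_const_mul]; ring) hδ (ae_of_all _ fun y hy => by
      rw [e] at hy
      exact mul_nonneg hκ0.le (sub_nonneg.2 (h y (by linarith)))) x
  rw [e] at h1
  linarith

theorem pot_pos {α : ℝ} (hα : 0 < α) (hn : α < dim E) {f : E → ℝ} (hf : BddCompact f)
    (h0 : ∀ x, 0 ≤ f x) (hpos : volume {x | 0 < f x} ≠ 0) (x : E) : 0 < pot α f x := by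
  have : Nontrivial E := by
    have : 0 < Module.finrank ℝ E := by exact_mod_cast hα.trans hn
    exact Module.finrank_pos_iff.1 this
  refine (pot_nonneg h0 x).lt_of_ne fun h => hpos ?_
  have h1 := (integral_eq_zero_iff_of_nonneg
    (fun y => mul_nonneg (rieszKer_nonneg α (x - y)) (h0 y))
    (integrable_rieszKer_mul hα hn hf x)).1 h.symm
  have h2 : ∀ᵐ y : E, y ≠ x := by simp [ae_iff]
  have h3 : ∀ᵐ y, ¬ 0 < f y := by
    filter_upwards [h1, h2] with y hy hyx hfy
    have : 0 < rieszKer α (x - y) :=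
      Real.rpow_pos_of_pos (norm_pos_iff.2 (sub_ne_zero.2 hyx.symm)) _
    exact (mul_pos this hfy).ne' hy
  simpa [ae_iff] using h3

theorem exists_ballTrunc_pos {ρ : E → ℝ} (h : 0 < volume {x | 0 < ρ x}) :
    ∃ n, volume {x | 0 < ballTrunc ρ n x} ≠ 0 := by
  by_contra! hcon
  have h1 : {x | 0 < ρ x} ⊆ ⋃ n, {x | 0 < ballTrunc ρ n x} := by
    intro x hx
    obtain ⟨n, hn⟩ := exists_nat_ge ‖x‖
    exact Set.mem_iUnion.2 ⟨n, by simpa [ballTrunc_of_le hn] using hx⟩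
  exact h.ne' (measure_mono_null h1 (measure_iUnion_null hcon))
end

section
variable {E : Type*} [NormedAddCommGroup E] [InnerProductSpace ℝ E] [FiniteDimensional ℝ E]
  [MeasurableSpace E] [BorelSpace E]

theorem exists_weak_solution {α κ : ℝ} (hα : 0 < α) (hα2 : α < 2) (hn : α < dim E)
    (hκ : ∀ θ : E → ℝ, ContDiff ℝ (⊤ : ℕ∞) θ → HasCompactSupport θ →
      ∀ x, ∫ y, rieszKer α y * levyOp α θ (x - y) = -κ * θ x)
    {ρ : E → ℝ} (hρm : Measurable ρ) (hρ0 : ∀ x, 0 ≤ ρ x)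
    (hρb : ∀ R : ℝ, ∃ M : ℝ, ∀ x : E, ‖x‖ ≤ R → ρ x ≤ M) (hρnt : 0 < volume {x | 0 < ρ x})
    {g : ℝ → ℝ} (hg0 : ∀ t, 0 < t → 0 < g t) (hga : AntitoneOn g (Set.Ioi 0))
    (hgc : ContinuousOn g (Set.Ioi 0))
    (hR : Tendsto (fun x : E => ∫⁻ y, ENNReal.ofReal (ρ y * rieszKer α (x - y)))
      (cocompact E) (𝓝 0)) :
    ∃ u : E → ℝ, Continuous u ∧ (∃ M, ∀ x, u x ≤ M) ∧ (∀ x, 0 < u x) ∧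
      Tendsto u (cocompact E) (𝓝 0) ∧
      ∀ θ : E → ℝ, ContDiff ℝ (⊤ : ℕ∞) θ → HasCompactSupport θ →
        ∫ x, u x * levyOp α θ x = -κ * ∫ x, ρ x * g (u x) * θ x := by
  have hL0 : ∀ n : ℕ, (0 : ℝ) < (n : ℝ) + 1 := fun n => by positivity
  have hB := bddCompact_ballTrunc hρm hρ0 hρb
  have hB0 := ballTrunc_nonneg hρ0
  have hex := fun n : ℕ => exists_pot_eq hα hn (hB n) (hB0 n) (ψ := lipReg g (n + 1))
    (lipReg_nonneg hg0 (hL0 n).le) (lipReg_le_const hg0 hga (hL0 n).le)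
    (lipReg_antitone hg0 hga (hL0 n).le) (hL0 n) (lipReg_lipschitz hg0 hga (hL0 n).le)
  choose u huc hFB hfix using hex
  set F : ℕ → E → ℝ := fun n y => ballTrunc ρ n y * lipReg g (n + 1) (u n y) with hF
  have hF0 : ∀ n y, 0 ≤ F n y := fun n y =>
    mul_nonneg (hB0 n y) (lipReg_nonneg hg0 (hL0 n).le _)
  have hu0 : ∀ n x, 0 ≤ u n x := fun n x => by rw [hfix]; exact pot_nonneg (hF0 n) x
  have hlow : ∀ η : ℝ, 0 < η → ∃ n0 : ℕ, ∀ n, n0 ≤ n → ∀ t, 0 ≤ t →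
      g (t + η) ≤ lipReg g (n + 1) t := by
    intro η hη
    obtain ⟨n0, hn0⟩ := exists_nat_ge (g η / η)
    refine ⟨n0, fun n hn t ht => le_lipReg_of_le hg0 hga hη ht ?_⟩
    rw [← div_le_iff₀ hη]
    have : (n0 : ℝ) ≤ n := by exact_mod_cast hn
    linarith
  -- uniform decay
  have hdecay : ∀ η : ℝ, 0 < η → ∃ R : ℝ, ∀ n x, R < ‖x‖ → u n x ≤ η := by
    intro η hη
    have hδ : 0 < η / 2 := half_pos hη
    have hgδ := hg0 _ hδ
    have h1 : ∀ n x, u n x ≤ g (η / 2) * pot α (ballTrunc ρ n) x + η / 2 := by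
      intro n x
      rw [hfix, ← pot_const_mul]
      refine pot_le_add_of hα hα2 hn (hFB n) ((hB n).const_mul _) hδ.le (fun y hy => ?_) x
      rw [← hfix, pot_const_mul] at hy
      have h2 : η / 2 < u n y := by
        have := mul_nonneg hgδ.le (pot_nonneg (α := α) (hB0 n) y)
        linarith
      have h3 : lipReg g (n + 1) (u n y) ≤ g (η / 2) :=
        (lipReg_le_self hg0 hgc (hL0 n).le (hδ.trans h2)).trans (hga hδ (hδ.trans h2) h2.le)
      rw [mul_comm]
      exact mul_le_mul_of_nonneg_right h3 (hB0 n y)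
    have hε : 0 < ENNReal.ofReal (η / 2 / g (η / 2)) := ENNReal.ofReal_pos.2 (by positivity)
    have h2 := (tendsto_order.1 hR).2 _ hε
    rw [← Metric.cobounded_eq_cocompact, ← comap_norm_atTop, eventually_comap] at h2
    obtain ⟨R, hR⟩ := eventually_atTop.1 h2
    refine ⟨R, fun n x hx => (h1 n x).trans ?_⟩
    have h3 : ENNReal.ofReal (pot α (ballTrunc ρ n) x) ≤ ENNReal.ofReal (η / 2 / g (η / 2)) := by
      refine le_trans ?_ (hR _ hx.le x rfl).le
      rw [ofReal_pot_eq hα hn (hB n) (hB0 n)]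
      exact lintegral_mono fun y => ENNReal.ofReal_le_ofReal
        (mul_le_mul_of_nonneg_right (ballTrunc_le hρ0 n y) (rieszKer_nonneg _ _))
    have h4 := (ENNReal.ofReal_le_ofReal_iff (by positivity)).1 h3
    rw [le_div_iff₀ hgδ] at h4
    linarith
  -- the approximations form a uniform Cauchy sequence
  have hcauchy : ∀ η : ℝ, 0 < η → ∃ n0 : ℕ, ∀ m n, n0 ≤ m → n0 ≤ n → ∀ x,
      u m x ≤ u n x + η := by
    intro η hη
    obtain ⟨R, hR⟩ := hdecay η hη
    obtain ⟨n1, hn1⟩ := hlow η hη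
    obtain ⟨n2, hn2⟩ := exists_nat_ge R
    refine ⟨max n1 n2, fun m n hm hn' x => ?_⟩
    rw [hfix m x, hfix n x]
    refine pot_le_add_of hα hα2 hn (hFB m) (hFB n) hη.le (fun y hy => ?_) x
    rw [← hfix, ← hfix] at hy
    have h0 := hu0 n y
    have hyR : ‖y‖ ≤ R := by
      by_contra! hlt
      have := hR m y hlt
      linarith
    have e : ∀ k, max n1 n2 ≤ k → ballTrunc ρ k y = ρ y := fun k hk => by
      refine ballTrunc_of_le (hyR.trans (hn2.trans ?_))
      exact_mod_cast (le_max_right _ _).trans hk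
    rw [e m hm, e n hn']
    refine mul_le_mul_of_nonneg_left ?_ (hρ0 y)
    have hpos : 0 < u n y + η := by linarith
    calc lipReg g (m + 1) (u m y) ≤ g (u m y) :=
          lipReg_le_self hg0 hgc (hL0 m).le (hpos.trans hy)
      _ ≤ g (u n y + η) := hga hpos (hpos.trans hy) hy.le
      _ ≤ lipReg g (n + 1) (u n y) := hn1 n ((le_max_left _ _).trans hn') _ h0
  have hlim : ∀ x, ∃ l, Tendsto (fun n => u n x) atTop (𝓝 l) := by
    intro x
    refine cauchySeq_tendsto_of_complete (Metric.cauchySeq_iff.2 fun ε hε => ?_)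
    obtain ⟨n0, h⟩ := hcauchy (ε / 2) (half_pos hε)
    refine ⟨n0, fun m hm n hn => ?_⟩
    rw [Real.dist_eq, abs_lt]
    have h1 := h m n hm hn x
    have h2 := h n m hn hm x
    constructor <;> linarith
  choose v hv using hlim
  have hunif : ∀ η : ℝ, 0 < η → ∃ n0 : ℕ, ∀ n, n0 ≤ n → ∀ x, |u n x - v x| ≤ η := by
    intro η hη
    obtain ⟨n0, h⟩ := hcauchy η hη
    refine ⟨n0, fun n hn x => abs_le.2 ⟨?_, ?_⟩⟩
    · have : v x ≤ u n x + η := le_of_tendsto (hv x) (by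
        filter_upwards [eventually_ge_atTop n0] with m hm using h m n hm hn x)
      linarith
    · have : u n x ≤ v x + η := ge_of_tendsto ((hv x).add_const η) (by
        filter_upwards [eventually_ge_atTop n0] with m hm using h n m hn hm x)
      linarith
  have hvc : Continuous v := by
    refine TendstoUniformly.continuous (F := u) (p := atTop) ?_ (Frequently.of_forall huc)
    rw [Metric.tendstoUniformly_iff]
    intro ε hε
    obtain ⟨n0, h⟩ := hunif (ε / 2) (half_pos hε)
    filter_upwards [eventually_ge_atTop n0] with n hn x
    rw [dist_comm, Real.dist_eq]
    linarith [h n hn x]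
  have hv0 : ∀ x, 0 ≤ v x := fun x => ge_of_tendsto' (hv x) fun n => hu0 n x
  -- uniform bound
  obtain ⟨n1, hn1⟩ := hunif 1 one_pos
  obtain ⟨U0, -, hU0⟩ := exists_abs_pot_le hα hn (hFB n1)
  set U := U0 + 2 with hU
  have hvU : ∀ x, v x ≤ U0 + 1 := fun x => by
    have h1 := abs_le.1 (hn1 n1 le_rfl x)
    have h2 := (le_abs_self _).trans (hU0 x)
    rw [← hfix] at h2
    linarith
  have huU : ∀ n, n1 ≤ n → ∀ x, u n x ≤ U := fun n hn x => by
    have h1 := abs_le.1 (hn1 n hn x)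
    have h2 := hvU x
    linarith
  have hU1 : 0 ≤ U := (hu0 n1 0).trans (huU n1 le_rfl 0)
  -- lower bound
  obtain ⟨k, hk⟩ := exists_ballTrunc_pos hρnt
  obtain ⟨n2, hn2⟩ := hlow 1 one_pos
  set ℓ : E → ℝ := fun x => g (U + 1) * pot α (ballTrunc ρ k) x with hℓ
  have hgU : 0 < g (U + 1) := hg0 _ (by linarith)
  have hℓ0 : ∀ x, 0 < ℓ x := fun x => mul_pos hgU (pot_pos hα hn (hB k) (hB0 k) hk x)
  have hℓc : Continuous ℓ := (continuous_pot hα hn (hB k)).const_mul _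
  have hℓu : ∃ n3, ∀ n, n3 ≤ n → ∀ x, ℓ x ≤ u n x := by
    refine ⟨max n1 (max n2 k), fun n hnn x => ?_⟩
    simp only [max_le_iff] at hnn
    rw [hfix]
    simp only [hℓ]
    rw [← pot_const_mul]
    refine pot_mono hα hn ((hB k).const_mul _) (hFB n) (fun y => ?_) x
    rw [mul_comm]
    refine mul_le_mul (ballTrunc_mono hρ0 hnn.2.2 y) ?_ hgU.le (hB0 n y)
    have h1 := hu0 n y
    have h2 := huU n hnn.1 y
    exact (hga (show 0 < u n y + 1 by linarith) (show 0 < U + 1 by linarith) (by linarith)).trans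
      (hn2 n hnn.2.1 _ h1)
  obtain ⟨n3, hn3⟩ := hℓu
  have hvℓ : ∀ x, ℓ x ≤ v x := fun x => ge_of_tendsto (hv x) (by
    filter_upwards [eventually_ge_atTop n3] with n hn using hn3 n hn x)
  have hvpos : ∀ x, 0 < v x := fun x => (hℓ0 x).trans_le (hvℓ x)
  -- convergence of the nonlinearity
  have hFlim : ∀ x, Tendsto (fun n => F n x) atTop (𝓝 (ρ x * g (v x))) := by
    intro x
    have h1 : Tendsto (fun n : ℕ => lipReg g (n + 1) (u n x)) atTop (𝓝 (g (v x))) := by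
      have hca : ContinuousAt g (v x) := hgc.continuousAt (Ioi_mem_nhds (hvpos x))
      rw [Metric.tendsto_atTop]
      intro ε hε
      obtain ⟨δ, hδ, hδ'⟩ := Metric.continuousAt_iff.1 hca ε hε
      obtain ⟨m1, hm1⟩ := hunif (δ / 3) (by linarith)
      obtain ⟨m2, hm2⟩ := hlow (δ / 3) (by linarith)
      refine ⟨max n3 (max m1 m2), fun n hnn => ?_⟩
      simp only [ge_iff_le, max_le_iff] at hnn
      have hup : 0 < u n x := (hℓ0 x).trans_le (hn3 n hnn.1 x)
      have a0 := abs_le.1 (hm1 n hnn.2.1 x)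
      have a1 := lipReg_le_self hg0 hgc (hL0 n).le hup
      have a2 := hm2 n hnn.2.2 _ hup.le
      have a3 := hδ' (x := u n x) (by rw [Real.dist_eq, abs_lt]; constructor <;> linarith)
      have a4 := hδ' (x := u n x + δ / 3) (by rw [Real.dist_eq, abs_lt]; constructor <;> linarith)
      rw [Real.dist_eq, abs_lt] at a3 a4 ⊢
      constructor <;> linarith
    obtain ⟨m, hm⟩ := exists_nat_ge ‖x‖
    refine (h1.const_mul (ρ x)).congr' ?_
    filter_upwards [eventually_ge_atTop m] with n hn
    simp only [hF]
    rw [ballTrunc_of_le (hm.trans (by exact_mod_cast hn))]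
  refine ⟨v, hvc, ⟨_, hvU⟩, hvpos, ?_, fun θ hθ hc => ?_⟩
  · rw [Metric.tendsto_nhds]
    intro ε hε
    obtain ⟨R, hR⟩ := hdecay (ε / 2) (half_pos hε)
    rw [← Metric.cobounded_eq_cocompact, ← comap_norm_atTop, eventually_comap]
    filter_upwards [eventually_gt_atTop R] with r hr x hx
    rw [Real.dist_eq, sub_zero, abs_of_nonneg (hv0 x)]
    have : v x ≤ ε / 2 := le_of_tendsto' (hv x) fun n => hR n x (hx ▸ hr)
    linarith
  · have hlevy := integrable_levyOp hα hα2 (hα.trans hn) hθ hc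
    have l1 : Tendsto (fun n => ∫ x, u n x * levyOp α θ x) atTop
        (𝓝 (∫ x, v x * levyOp α θ x)) := by
      refine tendsto_integral_filter_of_dominated_convergence (fun x => U * ‖levyOp α θ x‖)
        (.of_forall fun n => (huc n).aestronglyMeasurable.mul hlevy.1) ?_
        (hlevy.norm.const_mul _) (ae_of_all _ fun x => (hv x).mul_const _)
      filter_upwards [eventually_ge_atTop n1] with n hn
      refine ae_of_all _ fun x => ?_
      rw [norm_mul, Real.norm_of_nonneg (hu0 n x)]
      exact mul_le_mul_of_nonneg_right (huU n hn x) (norm_nonneg _)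
    have l2 : Tendsto (fun n => ∫ x, F n x * θ x) atTop (𝓝 (∫ x, ρ x * g (v x) * θ x)) := by
      have hK : IsCompact (tsupport θ) := hc
      obtain ⟨R, hRs⟩ := hK.isBounded.subset_closedBall 0
      obtain ⟨M, hM⟩ := hρb R
      obtain ⟨c, hc0, hcl⟩ : ∃ c, 0 < c ∧ ∀ x ∈ tsupport θ, c ≤ ℓ x := by
        rcases (tsupport θ).eq_empty_or_nonempty with h | h
        · exact ⟨1, one_pos, by simp [h]⟩
        · obtain ⟨x0, -, hx0⟩ := hK.exists_isMinOn h hℓc.continuousOn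
          exact ⟨ℓ x0, hℓ0 x0, fun x hx => hx0 hx⟩
      refine tendsto_integral_filter_of_dominated_convergence (fun x => M * g c * ‖θ x‖)
        (.of_forall fun n => (hFB n).measurable.aestronglyMeasurable.mul
          hθ.continuous.aestronglyMeasurable) ?_
        ((hθ.continuous.integrable_of_hasCompactSupport hc).norm.const_mul _)
        (ae_of_all _ fun x => (hFlim x).mul_const _)
      filter_upwards [eventually_ge_atTop n3] with n hn
      refine ae_of_all _ fun x => ?_
      by_cases hx : x ∈ tsupport θ
      · rw [norm_mul, Real.norm_of_nonneg (hF0 n x)]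
        refine mul_le_mul_of_nonneg_right ?_ (norm_nonneg _)
        have hcu : c ≤ u n x := (hcl x hx).trans (hn3 n hn x)
        have h1 : lipReg g (n + 1) (u n x) ≤ g c :=
          (lipReg_le_self hg0 hgc (hL0 n).le (hc0.trans_le hcu)).trans
            (hga hc0 (hc0.trans_le hcu) hcu)
        have h2 := hM x (by simpa using hRs hx)
        exact mul_le_mul ((ballTrunc_le hρ0 n x).trans h2) h1
          (lipReg_nonneg hg0 (hL0 n).le _) ((hρ0 x).trans h2)
      · simp [image_eq_zero_of_notMem_tsupport hx]
    refine tendsto_nhds_unique l1 ((l2.const_mul (-κ)).congr fun n => ?_)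
    rw [← weak_pot hα hα2 hn hκ (hFB n) hθ hc]
    simp_rw [← hfix n]
end

section
variable {N : ℕ} {α : ℝ}

theorem exists_sol_of_tendsto_riesz (hα : 0 < α) (hα2 : α < 2) (hN : 3 ≤ N)
    {ρ : EuclideanSpace ℝ (Fin N) → ℝ} (hρm : Measurable ρ) (hρnn : ∀ x, 0 ≤ ρ x)
    (hρlb : ∀ R : ℝ, ∃ M : ℝ, ∀ x : EuclideanSpace ℝ (Fin N), ‖x‖ ≤ R → ρ x ≤ M)
    (hρnt : 0 < volume {x : EuclideanSpace ℝ (Fin N) | 0 < ρ x})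
    {φ : ℝ → ℝ≥0∞} (hφc : ContinuousOn φ (Set.Ioi 0)) (hφanti : AntitoneOn φ (Set.Ioi 0))
    (hφpos : ∀ t : ℝ, 0 < t → 0 < φ t ∧ φ t < ⊤)
    (hR : Tendsto (fun x : EuclideanSpace ℝ (Fin N) =>
        ∫⁻ y, ENNReal.ofReal (ρ y * rieszKer α (x - y)))
      (cocompact (EuclideanSpace ℝ (Fin N))) (𝓝 0)) :
    ∃ u : EuclideanSpace ℝ (Fin N) → ℝ, NegEntireSol N α ρ φ u ∧
      Tendsto u (cocompact (EuclideanSpace ℝ (Fin N))) (𝓝 0) := by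
  have hn : α < dim (EuclideanSpace ℝ (Fin N)) := by
    rw [dim_euclideanSpace]
    have : (3 : ℝ) ≤ N := by exact_mod_cast hN
    linarith
  obtain ⟨κ, hκ0, hκ⟩ := exists_integral_rieszKer_mul_levyOp
    (E := EuclideanSpace ℝ (Fin N)) hα hα2 hn
  set c := fracLapCoeff N α / 2 with hc
  have hc0 : 0 < c := half_pos (fracLapCoeff_pos hα hα2)
  have hφr : ContinuousOn (fun t => (φ t).toReal) (Set.Ioi 0) :=
    ENNReal.continuousOn_toReal.comp hφc fun t ht => (hφpos t ht).2.ne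
  obtain ⟨u, huc, ⟨M, hM⟩, hupos, hu0, hweak⟩ := exists_weak_solution hα hα2 hn hκ hρm hρnn hρlb
    hρnt (g := fun t => (c * κ)⁻¹ * (φ t).toReal)
    (fun t ht => mul_pos (by positivity)
      (ENNReal.toReal_pos (hφpos t ht).1.ne' (hφpos t ht).2.ne))
    (fun s hs t ht hst => mul_le_mul_of_nonneg_left
      (ENNReal.toReal_mono (hφpos s hs).2.ne (hφanti hs ht hst)) (by positivity))
    (hφr.const_mul _) hR
  refine ⟨u, ⟨huc, ⟨M, hM⟩, fun x => (hupos x).le, fun K hK => ?_, fun θ hθ hcs => ?_⟩, hu0⟩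
  · rcases K.eq_empty_or_nonempty with h | h
    · simp [h]
    obtain ⟨x0, -, hx0⟩ := hK.exists_isMinOn h huc.continuousOn
    obtain ⟨R, hRs⟩ := hK.isBounded.subset_closedBall 0
    obtain ⟨A, hA⟩ := hρlb R
    have hb : ∀ x ∈ K, ENNReal.ofReal (ρ x) * φ (u x) ≤ ENNReal.ofReal A * φ (u x0) := fun x hx =>
      mul_le_mul' (ENNReal.ofReal_le_ofReal (hA x (by simpa using hRs hx)))
        (hφanti (hupos x0) (hupos x) (hx0 hx))
    refine ((setLIntegral_mono measurable_const hb).trans_lt ?_).ne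
    rw [setLIntegral_const]
    exact ENNReal.mul_lt_top (ENNReal.mul_lt_top ENNReal.ofReal_lt_top (hφpos _ (hupos x0)).2)
      hK.measure_lt_top
  · simp_rw [fracLap_eq, mul_left_comm _ (fracLapCoeff N α / 2)]
    rw [integral_const_mul, hweak θ hθ hcs, ← hc, ← integral_const_mul, ← integral_const_mul,
      ← integral_neg]
    refine integral_congr_ae (ae_of_all _ fun x => ?_)
    simp only
    rw [ENNReal.toReal_mul, ENNReal.toReal_ofReal (hρnn x)]
    field_simp
end

end FractionalPoisson

/-- `-Δ^{α/2}u = ρ·φ(u)` admits a nonnegative entire bounded solution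
decaying to zero at infinity iff the Riesz potential of `ρ` tends to zero at infinity. -/
theorem stmt17 (N : ℕ) (hN : 3 ≤ N) (α : ℝ) (hα1 : 0 < α) (hα2 : α < 2)
    (ρ : EuclideanSpace ℝ (Fin N) → ℝ) (hρm : Measurable ρ) (hρnn : ∀ x, 0 ≤ ρ x)
    (hρlb : ∀ R : ℝ, ∃ M : ℝ, ∀ x : EuclideanSpace ℝ (Fin N), ‖x‖ ≤ R → ρ x ≤ M)
    (hρnt : 0 < volume {x : EuclideanSpace ℝ (Fin N) | 0 < ρ x})
    (φ : ℝ → ℝ≥0∞)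
    (hφc : ContinuousOn φ (Set.Ioi 0)) (hφanti : AntitoneOn φ (Set.Ioi 0))
    (hφpos : ∀ t : ℝ, 0 < t → 0 < φ t ∧ φ t < ⊤)
    (hφ0 : Tendsto φ (nhdsWithin 0 (Set.Ioi 0)) (nhds (φ 0))) (hφ0pos : 0 < φ 0) :
    (∃ u : EuclideanSpace ℝ (Fin N) → ℝ, NegEntireSol N α ρ φ u ∧
      Tendsto u (cocompact (EuclideanSpace ℝ (Fin N))) (nhds 0)) ↔
    Tendsto (fun x : EuclideanSpace ℝ (Fin N) =>
        ∫⁻ y, ENNReal.ofReal (ρ y * ‖x - y‖ ^ (-((N : ℝ) - α))))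
      (cocompact (EuclideanSpace ℝ (Fin N))) (nhds 0) := by
  have hiff : (fun x : EuclideanSpace ℝ (Fin N) =>
      ∫⁻ y, ENNReal.ofReal (ρ y * ‖x - y‖ ^ (-((N : ℝ) - α)))) =
      fun x => ∫⁻ y, ENNReal.ofReal (ρ y * FractionalPoisson.rieszKer α (x - y)) := by
    simp_rw [FractionalPoisson.rieszKer_eq]
  rw [hiff]
  constructor
  · rintro ⟨u, hu, hu0⟩
    exact FractionalPoisson.tendsto_riesz_of_sol hα1 hα2 hN hρm hρnn hρlb hφc hφanti hφpos hφ0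
      hu hu0
  · exact FractionalPoisson.exists_sol_of_tendsto_riesz hα1 hα2 hN hρm hρnn hρlb hρnt hφc
      hφanti hφpos
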